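/- Let λ: ℝ → (0,∞) satisfy the admissibility condition. There exist constants C > 0 and M ≥ 0 such that ‖ψ_j Op_ħ(a) ψ_k u‖_{L²(dq)} ≤ C (‖a‖_{L^∞(ℝ^{3n})} + ħ^{1/2} |a|_{λ:M,0,0,t}) ‖u‖_{L²(dq)} for all t ∈ [0,1], all a ∈ BS^0_0(λ;t), all j, k ∈ ℤ, all ħ ∈ (0,1] and all u ∈ C_c^∞(ℝ^n). -/

import Mathlib

open MeasureTheory Real
open scoped BigOperators Classical

noncomputable section

/-- Points of `ℝⁿ`. The coordinate `q 0` plays the role of the radial variable `r`,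
the remaining coordinates are the angular variables `θ`. -/
abbrev Vec (n : ℕ) := Fin n → ℝ

/-- Complex-valued partial derivative in the coordinate direction `i`. -/
def pdC {n : ℕ} (i : Fin n) (f : Vec n → ℂ) : Vec n → ℂ :=
  fun x => fderiv ℝ f x (Pi.single i 1)

/-- Iterated (multiindex) partial derivative `∂^A f`. -/
def mpd {n : ℕ} (A : Fin n → ℕ) (f : Vec n → ℂ) : Vec n → ℂ :=
  (List.finRange n).foldr (fun i g => (pdC i)^[A i] g) f

/-- Real-valued partial derivative in the coordinate direction `i`. -/
def pdR {n : ℕ} (i : Fin n) (f : Vec n → ℝ) : Vec n → ℝ :=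
  fun x => fderiv ℝ f x (Pi.single i 1)

/-- Iterated (multiindex) partial derivative, real valued. -/
def mpdR {n : ℕ} (A : Fin n → ℕ) (f : Vec n → ℝ) : Vec n → ℝ :=
  (List.finRange n).foldr (fun i g => (pdR i)^[A i] g) f

/-- Total length `|A| = α₀ + |α|` of a multiindex. -/
def fullLen {n : ℕ} (A : Fin n → ℕ) : ℕ := ∑ i, A i

/-- Angular length `|α|` of a multiindex `A = (α₀, α)`. -/
def angLen {n : ℕ} [NeZero n] (A : Fin n → ℕ) : ℕ := ∑ i, if i = 0 then 0 else A i

/-- The weighted Japanese bracket `⟨ρ ⊕ μ⁻¹ η⟩ = (1 + ρ² + μ⁻²|η|²)^(1/2)`,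
where `ρ = p 0` and `η` are the remaining coordinates of `p`. -/
def jbr {n : ℕ} [NeZero n] (μ : ℝ) (p : Vec n) : ℝ :=
  Real.sqrt (1 + ∑ i, (if i = 0 then p i else μ⁻¹ * p i) ^ 2)

/-- Derivative `∂_q^A` of a function `a(q, p)` in the first slot. -/
def dqS {n : ℕ} (A : Fin n → ℕ) (a : Vec n → Vec n → ℂ) : Vec n → Vec n → ℂ :=
  fun q p => mpd A (fun x => a x p) q

/-- Derivative `∂_p^B` of a function `a(q, p)` in the second slot. -/
def dpS {n : ℕ} (B : Fin n → ℕ) (a : Vec n → Vec n → ℂ) : Vec n → Vec n → ℂ :=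
  fun q p => mpd B (fun x => a q x) p

/-- Derivative `∂_q^A` of a function `a(q, p, q')` in the first slot. -/
def d1B {n : ℕ} (A : Fin n → ℕ) (a : Vec n → Vec n → Vec n → ℂ) :
    Vec n → Vec n → Vec n → ℂ :=
  fun q p q' => mpd A (fun x => a x p q') q

/-- Derivative `∂_p^B` of a function `a(q, p, q')` in the second slot. -/
def d2B {n : ℕ} (B : Fin n → ℕ) (a : Vec n → Vec n → Vec n → ℂ) :
    Vec n → Vec n → Vec n → ℂ :=
  fun q p q' => mpd B (fun x => a q x q') p

/-- Derivative `∂_{q'}^{A'}` of a function `a(q, p, q')` in the third slot. -/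
def d3B {n : ℕ} (A' : Fin n → ℕ) (a : Vec n → Vec n → Vec n → ℂ) :
    Vec n → Vec n → Vec n → ℂ :=
  fun q p q' => mpd A' (fun x => a q p x) q'

/-- The admissibility condition for the weight `λ : ℝ → (0,∞)`:
`λ` is positive and `C₀⁻¹ ≤ λ(r)/λ(r') ≤ C₀` whenever `|r - r'| ≤ 1`. -/
def Admissible (lam : ℝ → ℝ) : Prop :=
  (∀ r, 0 < lam r) ∧
  ∃ C > 0, ∀ r r' : ℝ, |r - r'| ≤ 1 → C⁻¹ ≤ lam r / lam r' ∧ lam r / lam r' ≤ C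

/-- The symbol class `S^m_σ(λ)`:  `a` is smooth on `ℝ^{2n}` and for all multiindices
`A = (α₀, α)`, `B = (β₀, β)`,
`|(λ(r)⁻¹∂_θ)^α (λ(r)∂_η)^β ∂_r^{α₀} ∂_ρ^{β₀} a(q,p)| ≤ C ⟨ρ ⊕ λ(r)⁻¹η⟩^{m - σ|B|}`.
(The weights `λ(r)^{±1}` commute with the `θ`- and `η`-derivatives, so the weighted
derivative equals `λ(r)^{|β| - |α|}` times the plain mixed partial derivative.) -/
def IsSymbol {n : ℕ} [NeZero n] (lam : ℝ → ℝ) (m σ : ℝ) (a : Vec n → Vec n → ℂ) : Prop :=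
  ContDiff ℝ (⊤ : ℕ∞) (fun x : Vec n × Vec n => a x.1 x.2) ∧
  ∀ A B : Fin n → ℕ, ∃ C > 0, ∀ q p : Vec n,
    lam (q 0) ^ ((angLen B : ℤ) - (angLen A : ℤ)) * ‖dqS A (dpS B a) q p‖
      ≤ C * jbr (lam (q 0)) p ^ (m - σ * (fullLen B : ℝ))

/-- The seminorm `|a|_{λ : M, m, σ}` on the symbol class `S^m_σ(λ)`. -/
def symSeminorm {n : ℕ} [NeZero n] (lam : ℝ → ℝ) (M : ℕ) (m σ : ℝ)
    (a : Vec n → Vec n → ℂ) : ℝ :=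
  ∑ A : Fin n → Fin (M + 1), ∑ B : Fin n → Fin (M + 1),
    if fullLen (fun i => (A i : ℕ)) + fullLen (fun i => (B i : ℕ)) ≤ M then
      ⨆ q : Vec n, ⨆ p : Vec n,
        jbr (lam (q 0)) p ^ (-m + σ * (fullLen (fun i => (B i : ℕ)) : ℝ)) *
          (lam (q 0) ^ ((angLen (fun i => (B i : ℕ)) : ℤ) - (angLen (fun i => (A i : ℕ)) : ℤ)) *
            ‖dqS (fun i => (A i : ℕ)) (dpS (fun i => (B i : ℕ)) a) q p‖)
    else 0

/-- `λ^t_{jk} := λ(tj + (1-t)k)`. -/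
def lamT (lam : ℝ → ℝ) (t : ℝ) (j k : ℤ) : ℝ := lam (t * j + (1 - t) * k)

/-- The bisymbol class `BS^m_σ(λ; t)`. -/
def IsBisymbol {n : ℕ} [NeZero n] (lam : ℝ → ℝ) (m σ t : ℝ)
    (a : Vec n → Vec n → Vec n → ℂ) : Prop :=
  ContDiff ℝ (⊤ : ℕ∞) (fun x : Vec n × Vec n × Vec n => a x.1 x.2.1 x.2.2) ∧
  ∀ A B A' : Fin n → ℕ, ∃ C > 0, ∀ (j k : ℤ) (q p q' : Vec n),
    |q 0 - (j : ℝ)| ≤ 1 → |q' 0 - (k : ℝ)| ≤ 1 →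
    lamT lam t j k ^ ((angLen B : ℤ) - (angLen A : ℤ) - (angLen A' : ℤ)) *
        ‖d1B A (d2B B (d3B A' a)) q p q'‖
      ≤ C * jbr (lamT lam t j k) p ^ (m - σ * (fullLen B : ℝ))

/-- The seminorm `|a|_{λ : M, m, σ, t}` on `BS^m_σ(λ; t)`. -/
def bisymSeminorm {n : ℕ} [NeZero n] (lam : ℝ → ℝ) (M : ℕ) (m σ t : ℝ)
    (a : Vec n → Vec n → Vec n → ℂ) : ℝ :=
  ∑ A : Fin n → Fin (M + 1), ∑ B : Fin n → Fin (M + 1), ∑ A' : Fin n → Fin (M + 1),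
    if fullLen (fun i => (A i : ℕ)) + fullLen (fun i => (B i : ℕ))
        + fullLen (fun i => (A' i : ℕ)) ≤ M then
      ⨆ j : ℤ, ⨆ k : ℤ, ⨆ q : Vec n, ⨆ p : Vec n, ⨆ q' : Vec n,
        if |q 0 - (j : ℝ)| ≤ 1 ∧ |q' 0 - (k : ℝ)| ≤ 1 then
          jbr (lamT lam t j k) p ^ (-m + σ * (fullLen (fun i => (B i : ℕ)) : ℝ)) *
            (lamT lam t j k ^ ((angLen (fun i => (B i : ℕ)) : ℤ)
                - (angLen (fun i => (A i : ℕ)) : ℤ) - (angLen (fun i => (A' i : ℕ)) : ℤ)) *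
              ‖d1B (fun i => (A i : ℕ)) (d2B (fun i => (B i : ℕ))
                  (d3B (fun i => (A' i : ℕ)) a)) q p q'‖)
        else 0
    else 0

/-- The plain bisymbol class `BS^m_σ(1)` (the case `λ ≡ 1`). -/
def IsBisymbolOne {n : ℕ} [NeZero n] (m σ : ℝ) (a : Vec n → Vec n → Vec n → ℂ) : Prop :=
  ContDiff ℝ (⊤ : ℕ∞) (fun x : Vec n × Vec n × Vec n => a x.1 x.2.1 x.2.2) ∧
  ∀ A B A' : Fin n → ℕ, ∃ C > 0, ∀ q p q' : Vec n,
    ‖d1B A (d2B B (d3B A' a)) q p q'‖ ≤ C * jbr 1 p ^ (m - σ * (fullLen B : ℝ))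

/-- The seminorm `|a|_{M, m, σ}` on `BS^m_σ(1)`. -/
def bisymSeminormOne {n : ℕ} [NeZero n] (M : ℕ) (m σ : ℝ)
    (a : Vec n → Vec n → Vec n → ℂ) : ℝ :=
  ∑ A : Fin n → Fin (M + 1), ∑ B : Fin n → Fin (M + 1), ∑ A' : Fin n → Fin (M + 1),
    if fullLen (fun i => (A i : ℕ)) + fullLen (fun i => (B i : ℕ))
        + fullLen (fun i => (A' i : ℕ)) ≤ M then
      ⨆ q : Vec n, ⨆ p : Vec n, ⨆ q' : Vec n,
        jbr 1 p ^ (-m + σ * (fullLen (fun i => (B i : ℕ)) : ℝ)) *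
          ‖d1B (fun i => (A i : ℕ)) (d2B (fun i => (B i : ℕ))
              (d3B (fun i => (A' i : ℕ)) a)) q p q'‖
    else 0

/-- The oscillatory phase `e^{i p · (q - q')}`. -/
def phase {n : ℕ} (p q q' : Vec n) : ℂ :=
  Complex.exp (Complex.I * ((∑ i, p i * (q i - q' i) : ℝ) : ℂ))

/-- The pseudodifferential operator `Op^g(a)` with bisymbol `a`, as an iterated integral:
`Op^g(a)u(q) = (2π)^{-n} g(q)^{-1/4} ∫ dp ∫ dq' a(q,p,q') e^{ip⋅(q-q')} u(q') g(q')^{1/4}`. -/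
def OpG {n : ℕ} (g : Vec n → ℝ) (a : Vec n → Vec n → Vec n → ℂ) (u : Vec n → ℂ) :
    Vec n → ℂ :=
  fun q => (((2 * Real.pi) ^ (-(n : ℤ)) : ℝ) : ℂ) * ((g q ^ (-(1 : ℝ) / 4) : ℝ) : ℂ) *
    ∫ p : Vec n, ∫ q' : Vec n,
      a q p q' * phase p q q' * u q' * ((g q' ^ ((1 : ℝ) / 4) : ℝ) : ℂ)

/-- The pseudodifferential operator `Op(a) = Op^1(a)` with bisymbol `a`. -/
def Op {n : ℕ} (a : Vec n → Vec n → Vec n → ℂ) (u : Vec n → ℂ) : Vec n → ℂ :=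
  fun q => (((2 * Real.pi) ^ (-(n : ℤ)) : ℝ) : ℂ) *
    ∫ p : Vec n, ∫ q' : Vec n, a q p q' * phase p q q' * u q'

/-- The `t`-quantization `Op^{g,t}(a)` of a symbol `a`. -/
def OpSt {n : ℕ} (g : Vec n → ℝ) (t : ℝ) (a : Vec n → Vec n → ℂ) (u : Vec n → ℂ) :
    Vec n → ℂ :=
  OpG g (fun q p q' => a (t • q + (1 - t) • q') p) u

/-- The quantization `Op(b)` of a symbol `b` (the case `t = 1`, `g ≡ 1`). -/
def OpSym {n : ℕ} (b : Vec n → Vec n → ℂ) (u : Vec n → ℂ) : Vec n → ℂ :=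
  Op (fun q p _ => b q p) u

/-- The `L²(g^{1/2}dq)` norm. -/
def L2g {n : ℕ} (g : Vec n → ℝ) (f : Vec n → ℂ) : ℝ :=
  Real.sqrt (∫ q : Vec n, ‖f q‖ ^ 2 * Real.sqrt (g q))

/-- The `L²(dq)` norm. -/
def L2 {n : ℕ} (f : Vec n → ℂ) : ℝ :=
  Real.sqrt (∫ q : Vec n, ‖f q‖ ^ 2)

end

noncomputable section

/-- The semiclassical quantization `Op_ħ(a) := Op(a(q, ħp, q'))`. -/
def Oph {n : ℕ} (h : ℝ) (a : Vec n → Vec n → Vec n → ℂ) (u : Vec n → ℂ) : Vec n → ℂ :=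
  Op (fun q p q' => a q (h • p) q') u

/-- The supremum norm `‖a‖_{L^∞(ℝ^{3n})}` of a bisymbol. -/
def biSup {n : ℕ} (a : Vec n → Vec n → Vec n → ℂ) : ℝ :=
  ⨆ q : Vec n, ⨆ p : Vec n, ⨆ q' : Vec n, ‖a q p q'‖

end

/-- The Gaussian weight `exp (-b |ξ|²)`. -/
noncomputable def gaussWeight {n : ℕ} (b : ℝ) (ξ : Vec n) : ℝ := Real.exp (-b * ∑ i, ξ i ^ 2)

lemma gaussWeight_pos {n : ℕ} (b : ℝ) (ξ : Vec n) : 0 < gaussWeight b ξ := Real.exp_pos _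

lemma continuous_gaussWeight {n : ℕ} (b : ℝ) : Continuous (gaussWeight (n := n) b) := by
  unfold gaussWeight; fun_prop

lemma gaussWeight_eq_prod {n : ℕ} (b : ℝ) (ξ : Vec n) :
    gaussWeight b ξ = ∏ i, Real.exp (-b * ξ i ^ 2) := by
  rw [gaussWeight, Finset.mul_sum, Real.exp_sum]

lemma integrable_gaussWeight {n : ℕ} {b : ℝ} (hb : 0 < b) :
    Integrable (gaussWeight (n := n) b) := by
  simp_rw [funext (gaussWeight_eq_prod (n := n) b)]
  exact Integrable.fintype_prod (f := fun _ (x : ℝ) => Real.exp (-b * x ^ 2))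
    fun _ => integrable_exp_neg_mul_sq hb

lemma integral_gaussWeight {n : ℕ} (b : ℝ) :
    ∫ ξ : Vec n, gaussWeight b ξ = Real.sqrt (π / b) ^ n := by
  simp_rw [gaussWeight_eq_prod]
  rw [integral_fintype_prod_volume_eq_prod (f := fun _ (x : ℝ) => Real.exp (-b * x ^ 2))]
  simp only [integral_gaussian, Finset.prod_const, Finset.card_univ, Fintype.card_fin]

lemma norm_phase {n : ℕ} (p q q' : Vec n) : ‖phase p q q'‖ = 1 := by
  rw [phase, mul_comm, Complex.norm_exp_ofReal_mul_I]

lemma continuous_phase {n : ℕ} :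
    Continuous fun z : Vec n × Vec n × Vec n => phase z.2.1 z.1 z.2.2 := by
  unfold phase; fun_prop

lemma phase_eq_mul {n : ℕ} (p q q' : Vec n) : phase p q q' = phase p q 0 * phase p 0 q' := by
  simp only [phase, ← Complex.exp_add, ← mul_add, ← Complex.ofReal_add, ← Finset.sum_add_distrib]
  congr 3
  refine Finset.sum_congr rfl fun i _ => ?_
  simp only [Pi.zero_apply]; ring

lemma conj_phase {n : ℕ} (p q q' : Vec n) :
    (starRingEnd ℂ) (phase p q q') = phase p q' q := by
  rw [phase, phase, ← Complex.exp_conj, map_mul, Complex.conj_I, Complex.conj_ofReal]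
  congr 1
  rw [neg_mul, ← mul_neg, ← Complex.ofReal_neg, ← Finset.sum_neg_distrib]
  congr 2
  refine Finset.sum_congr rfl fun i _ => ?_
  ring

lemma norm_integral_gaussWeight_phase {n : ℕ} {b : ℝ} (hb : 0 < b) (x y : Vec n) :
    ‖∫ ξ : Vec n, (gaussWeight b ξ : ℂ) * phase ξ x y‖ =
      Real.sqrt (π / b) ^ n * gaussWeight (1 / (4 * b)) (x - y) := by
  have h1 : ∀ ξ : Vec n, (gaussWeight b ξ : ℂ) * phase ξ x y =
      Complex.exp (-∑ i, (b : ℂ) * (ξ i : ℂ) ^ 2 + ∑ i, (Complex.I * ((x i - y i : ℝ) : ℂ)) * ξ i) := by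
    intro ξ
    rw [Complex.exp_add, gaussWeight, phase]
    push_cast
    congr 2
    · rw [Finset.mul_sum, ← Finset.sum_neg_distrib]
      exact Finset.sum_congr rfl fun i _ => by ring
    · rw [Finset.mul_sum]
      exact Finset.sum_congr rfl fun i _ => by ring
  simp_rw [h1]
  rw [GaussianFourier.integral_cexp_neg_sum_mul_add (b := fun _ : Fin n => (b : ℂ))
    (fun _ => by simpa using hb)]
  have h2 : ‖((π : ℂ) / (b : ℂ)) ^ (1 / 2 : ℂ)‖ = Real.sqrt (π / b) := by
    rw [← Complex.ofReal_div, show (1 / 2 : ℂ) = ((1 / 2 : ℝ) : ℂ) by push_cast; rfl,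
      Complex.norm_cpow_eq_rpow_re_of_pos (by positivity), Complex.ofReal_re, Real.sqrt_eq_rpow]
  rw [norm_prod]
  simp_rw [norm_mul, h2]
  rw [Finset.prod_mul_distrib, gaussWeight_eq_prod]
  simp only [Finset.prod_const, Finset.card_univ, Fintype.card_fin]
  congr 1
  refine Finset.prod_congr rfl fun i _ => ?_
  rw [Complex.norm_exp]
  congr 1
  rw [mul_pow, Complex.I_sq, show (-1 * ((x i - y i : ℝ) : ℂ) ^ 2 / (4 * (b : ℂ))) =
    ((-(1 / (4 * b)) * (x i - y i) ^ 2 : ℝ) : ℂ) by push_cast; field_simp, Complex.ofReal_re,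
    Pi.sub_apply]

lemma sqrt_pi_div_mul {b : ℝ} (hb : 0 < b) :
    Real.sqrt (π / b) * Real.sqrt (π / (1 / (4 * b))) = 2 * π := by
  rw [← Real.sqrt_mul (by positivity), show π / b * (π / (1 / (4 * b))) = (2 * π) ^ 2 by
    field_simp; ring, Real.sqrt_sq (by positivity)]

/-- Weighted Bessel inequality for the Fourier transform. -/
lemma integral_gaussWeight_mul_normSq_le {n : ℕ} {b : ℝ} (hb : 0 < b) {v : Vec n → ℂ}
    (hv : Integrable v) (hv2 : Integrable fun x => ‖v x‖ ^ 2) :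
    ∫ ξ : Vec n, gaussWeight b ξ * ‖∫ x, phase ξ x 0 * v x‖ ^ 2
      ≤ (2 * π) ^ n * ∫ x, ‖v x‖ ^ 2 := by
  set G : Vec n → ℝ := gaussWeight (1 / (4 * b)) with hG
  have hGi : Integrable G := integrable_gaussWeight (by positivity)
  have hbase : Integrable (fun z : Vec n × Vec n × Vec n =>
      (gaussWeight b z.1 : ℂ) * (v z.2.1 * (starRingEnd ℂ) (v z.2.2))) := by
    refine Integrable.mul_prod (f := fun ξ : Vec n => (gaussWeight b ξ : ℂ))
      (g := fun w : Vec n × Vec n => v w.1 * (starRingEnd ℂ) (v w.2)) ?_ ?_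
    · exact (integrable_gaussWeight hb).ofReal
    · refine Integrable.mul_prod (f := v) (g := fun y => (starRingEnd ℂ) (v y)) hv ?_
      simpa using (Complex.conjCLE.toContinuousLinearMap.integrable_comp hv)
  have htri : Integrable (fun z : Vec n × Vec n × Vec n =>
      (gaussWeight b z.1 : ℂ) * phase z.1 z.2.1 z.2.2 *
        (v z.2.1 * (starRingEnd ℂ) (v z.2.2))) := by
    have hc : Continuous fun z : Vec n × Vec n × Vec n => phase z.1 z.2.1 z.2.2 := by
      unfold phase; fun_prop
    refine hbase.mono ?_ (Filter.Eventually.of_forall fun z => ?_)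
    · have := hc.aestronglyMeasurable.mul hbase.aestronglyMeasurable
        (μ := (volume : Measure (Vec n × Vec n × Vec n)))
      refine this.congr (Filter.Eventually.of_forall fun z => ?_)
      simp only [Pi.mul_apply]; ring
    · rw [norm_mul, norm_mul, norm_mul, norm_phase, mul_one, norm_mul, norm_mul]
  have e1 : ((∫ ξ : Vec n, gaussWeight b ξ * ‖∫ x, phase ξ x 0 * v x‖ ^ 2 : ℝ) : ℂ) =
      ∫ w : Vec n × Vec n, (∫ ξ : Vec n, (gaussWeight b ξ : ℂ) * phase ξ w.1 w.2) *
        (v w.1 * (starRingEnd ℂ) (v w.2)) := by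
    rw [← integral_complex_ofReal]
    have : ∀ w : Vec n × Vec n, (∫ ξ : Vec n, (gaussWeight b ξ : ℂ) * phase ξ w.1 w.2) *
        (v w.1 * (starRingEnd ℂ) (v w.2)) = ∫ ξ : Vec n, (gaussWeight b ξ : ℂ) *
          phase ξ w.1 w.2 * (v w.1 * (starRingEnd ℂ) (v w.2)) := fun w => by
      rw [integral_mul_const]
    simp_rw [this]
    rw [← integral_integral_swap htri]
    refine integral_congr_ae (Filter.Eventually.of_forall fun ξ => ?_)
    simp only
    simp_rw [mul_assoc]
    rw [integral_const_mul]
    push_cast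
    congr 1
    rw [← Complex.mul_conj', ← integral_conj, ← integral_prod_mul]
    refine integral_congr_ae (Filter.Eventually.of_forall fun w => ?_)
    simp only [map_mul, conj_phase]
    rw [phase_eq_mul ξ w.1 w.2]; ring
  have hsym : ∀ x y : Vec n, G (x - y) = G (-y + x) ∧ G (x - y) = G (-x + y) := by
    intro x y
    refine ⟨by rw [neg_add_eq_sub], ?_⟩
    simp only [hG, gaussWeight, Pi.sub_apply, Pi.add_apply, Pi.neg_apply]
    congr 2
    exact Finset.sum_congr rfl fun i _ => by ring
  have hP := hv2.mul_prod hGi (μ := (volume : Measure (Vec n)))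
    (ν := (volume : Measure (Vec n)))
  have hPint := integral_prod_mul (μ := (volume : Measure (Vec n)))
    (ν := (volume : Measure (Vec n))) (fun x => ‖v x‖ ^ 2) G
  have hm1 := measurePreserving_prod_neg_add (volume : Measure (Vec n)) (volume : Measure (Vec n))
  have hm2 := measurePreserving_prod_neg_add_swap
    (volume : Measure (Vec n)) (volume : Measure (Vec n))
  have hi1 := hm1.integrable_comp hP.aestronglyMeasurable |>.2 hP
  have hi2 := hm2.integrable_comp hP.aestronglyMeasurable |>.2 hP
  have hv1 := integral_map hm1.measurable.aemeasurable (hm1.map_eq.symm ▸ hP.aestronglyMeasurable)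
  have hv2' := integral_map hm2.measurable.aemeasurable (hm2.map_eq.symm ▸ hP.aestronglyMeasurable)
  rw [hm1.map_eq, hPint] at hv1
  rw [hm2.map_eq, hPint] at hv2'
  have hsum := (hi1.add hi2).const_mul (Real.sqrt (π / b) ^ n / 2)
  calc _ = ‖((∫ ξ : Vec n, gaussWeight b ξ * ‖∫ x, phase ξ x 0 * v x‖ ^ 2 : ℝ) : ℂ)‖ := by
        rw [Complex.norm_real, Real.norm_of_nonneg]
        exact integral_nonneg fun ξ => mul_nonneg (gaussWeight_pos b ξ).le (by positivity)
    _ ≤ ∫ w : Vec n × Vec n, Real.sqrt (π / b) ^ n / 2 *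
          (‖v w.1‖ ^ 2 * G (-w.1 + w.2) + ‖v w.2‖ ^ 2 * G (-w.2 + w.1)) := by
        rw [e1]
        refine norm_integral_le_of_norm_le hsum (Filter.Eventually.of_forall fun w => ?_)
        rw [norm_mul, norm_integral_gaussWeight_phase hb, ← hG, norm_mul, RCLike.norm_conj,
          ← (hsym w.1 w.2).1, ← (hsym w.1 w.2).2]
        have hGp : 0 ≤ G (w.1 - w.2) := (gaussWeight_pos _ _).le
        have hc : 0 ≤ Real.sqrt (π / b) ^ n * G (w.1 - w.2) := by positivity
        nlinarith [mul_nonneg hc (sq_nonneg (‖v w.1‖ - ‖v w.2‖))]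
    _ = _ := by
        rw [integral_const_mul]
        simp only [Measure.volume_eq_prod]
        have := integral_add hi1 hi2
        simp only [Function.comp_def] at this
        rw [this]
        have hI : ∫ x, G x = Real.sqrt (π / (1 / (4 * b))) ^ n := integral_gaussWeight _
        have e2 : (Real.sqrt (π / b) * Real.sqrt (π / (1 / (4 * b)))) ^ n = (2 * π) ^ n := by
          rw [sqrt_pi_div_mul hb]
        rw [mul_pow] at e2
        rw [← e2, ← hI]
        rw [← hv1, ← hv2']
        ring

lemma L2_nonneg {n : ℕ} (f : Vec n → ℂ) : 0 ≤ L2 f := Real.sqrt_nonneg _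

lemma L2_sq {n : ℕ} (f : Vec n → ℂ) : L2 f ^ 2 = ∫ x, ‖f x‖ ^ 2 :=
  Real.sq_sqrt (integral_nonneg fun _ => by positivity)

/-- Bounded measurable functions with bounded support. -/
structure BddSupp {n : ℕ} (v : Vec n → ℂ) : Prop where
  measurable : Measurable v
  exists_bound : ∃ C R : ℝ, ∀ x, ‖v x‖ ≤ C ∧ (R < ‖x‖ → v x = 0)

lemma integrable_of_bdd_of_compact {Y : Type*} [TopologicalSpace Y] [T2Space Y] [MeasurableSpace Y]
    [OpensMeasurableSpace Y] {μ : Measure Y} [IsFiniteMeasureOnCompacts μ] {S : Set Y}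
    (hS : IsCompact S) {f : Y → ℂ} (hf : AEStronglyMeasurable f μ) {C : ℝ}
    (hC : ∀ y ∈ S, ‖f y‖ ≤ C) (h0 : ∀ y ∉ S, f y = 0) : Integrable f μ := by
  rw [← integrableOn_iff_integrable_of_support_subset (s := S)
    (fun y hy => by_contra fun h => hy (h0 y h))]
  exact Measure.integrableOn_of_bounded hS.measure_lt_top.ne hf
    ((ae_restrict_iff' hS.measurableSet).2 (Filter.Eventually.of_forall hC))

namespace BddSupp

variable {n : ℕ} {v u : Vec n → ℂ}

lemma integrable (hv : BddSupp v) : Integrable v := by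
  obtain ⟨C, R, h⟩ := hv.exists_bound
  refine integrable_of_bdd_of_compact (isCompact_closedBall (0 : Vec n) R)
    hv.measurable.aestronglyMeasurable (fun x _ => (h x).1) (fun x hx => (h x).2 ?_)
  simpa using hx

lemma integrable_sq (hv : BddSupp v) : Integrable fun x => ‖v x‖ ^ 2 := by
  obtain ⟨C, R, h⟩ := hv.exists_bound
  refine (hv.integrable.norm.const_mul C).mono'
    (hv.measurable.norm.pow_const 2).aestronglyMeasurable (Filter.Eventually.of_forall fun x => ?_)
  rw [Real.norm_of_nonneg (by positivity), sq]
  exact mul_le_mul_of_nonneg_right (h x).1 (norm_nonneg _)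

lemma of_le (hv : BddSupp v) (hu : Measurable u) {K : ℝ} (h : ∀ x, ‖u x‖ ≤ K * ‖v x‖) :
    BddSupp u := by
  obtain ⟨C, R, h'⟩ := hv.exists_bound
  refine ⟨hu, |K| * C, R, fun x => ⟨(h x).trans ?_, fun hx => ?_⟩⟩
  · exact mul_le_mul (le_abs_self _) (h' x).1 (norm_nonneg _) (abs_nonneg _)
  · have := h x
    rw [(h' x).2 hx, norm_zero, mul_zero] at this
    exact norm_le_zero_iff.1 this

lemma L2_le (hv : BddSupp v) {K : ℝ} (hK : 0 ≤ K) (h : ∀ x, ‖u x‖ ≤ K * ‖v x‖) :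
    L2 u ≤ K * L2 v := by
  rw [L2, L2, ← Real.sqrt_sq hK, ← Real.sqrt_mul (sq_nonneg K), ← integral_const_mul]
  refine Real.sqrt_le_sqrt (integral_mono_of_nonneg (Filter.Eventually.of_forall fun x => ?_)
    (hv.integrable_sq.const_mul _) (Filter.Eventually.of_forall fun x => ?_))
  · positivity
  · change ‖u x‖ ^ 2 ≤ K ^ 2 * ‖v x‖ ^ 2
    rw [← mul_pow]
    exact pow_le_pow_left₀ (norm_nonneg _) (h x) 2

end BddSupp

lemma integral_mul_le_sqrt_mul_sqrt {X : Type*} [MeasurableSpace X] {μ : Measure X} {f g : X → ℝ}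
    (hf0 : ∀ x, 0 ≤ f x) (hg0 : ∀ x, 0 ≤ g x) (hf : AEStronglyMeasurable f μ)
    (hg : AEStronglyMeasurable g μ) (hf2 : Integrable (fun x => f x ^ 2) μ)
    (hg2 : Integrable (fun x => g x ^ 2) μ) :
    ∫ x, f x * g x ∂μ ≤ Real.sqrt (∫ x, f x ^ 2 ∂μ) * Real.sqrt (∫ x, g x ^ 2 ∂μ) := by
  have hm : ∀ {h : X → ℝ}, AEStronglyMeasurable h μ → Integrable (fun x => h x ^ 2) μ →
      MemLp h (ENNReal.ofReal 2) μ := fun h1 h2 => by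
    rw [show ENNReal.ofReal 2 = 2 by norm_num]
    exact (memLp_two_iff_integrable_sq h1).2 h2
  have := integral_mul_le_Lp_mul_Lq_of_nonneg (μ := μ) (f := f) (g := g)
    Real.HolderConjugate.two_two (Filter.Eventually.of_forall hf0)
    (Filter.Eventually.of_forall hg0) (hm hf hf2) (hm hg hg2)
  simpa only [Real.rpow_two, Real.sqrt_eq_rpow] using this

/-- `ξ ↦ ∫ e^{i ξ·x} v(x) dx`. -/
noncomputable def expTransform {n : ℕ} (v : Vec n → ℂ) (ξ : Vec n) : ℂ := ∫ x, phase ξ x 0 * v x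

section expTransform

variable {n : ℕ} {v : Vec n → ℂ}

lemma norm_expTransform_le (v : Vec n → ℂ) (ξ : Vec n) : ‖expTransform v ξ‖ ≤ ∫ x, ‖v x‖ := by
  refine (norm_integral_le_integral_norm _).trans_eq ?_
  simp only [norm_mul, norm_phase, one_mul]

lemma stronglyMeasurable_expTransform (hv : Measurable v) :
    StronglyMeasurable (expTransform v) := by
  have hc : Continuous fun z : Vec n × Vec n => phase z.1 z.2 0 := by
    unfold phase; fun_prop
  exact StronglyMeasurable.integral_prod_right
    (f := fun ξ x => phase ξ x 0 * v x) ((hc.measurable.mul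
      (hv.comp measurable_snd)).stronglyMeasurable)

lemma integrable_gaussWeight_mul_expTransform_sq {b : ℝ} (hb : 0 < b) (hv : Measurable v) :
    Integrable fun ξ => (Real.sqrt (gaussWeight b ξ) * ‖expTransform v ξ‖) ^ 2 := by
  have : (fun ξ => (Real.sqrt (gaussWeight b ξ) * ‖expTransform v ξ‖) ^ 2) =
      fun ξ => gaussWeight b ξ * ‖expTransform v ξ‖ ^ 2 := by
    ext ξ; rw [mul_pow, Real.sq_sqrt (gaussWeight_pos b ξ).le]
  rw [this]
  refine ((integrable_gaussWeight hb).mul_const ((∫ x, ‖v x‖) ^ 2)).mono'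
    ((continuous_gaussWeight b).aestronglyMeasurable.mul
      ((stronglyMeasurable_expTransform hv).norm.pow 2).aestronglyMeasurable)
    (Filter.Eventually.of_forall fun ξ => ?_)
  have h1 := (gaussWeight_pos b ξ).le
  rw [Real.norm_of_nonneg (by positivity)]
  gcongr
  exact norm_expTransform_le v ξ

lemma sqrt_integral_gaussWeight_mul_expTransform_le {b : ℝ} (hb : 0 < b) (hv : BddSupp v) :
    Real.sqrt (∫ ξ, (Real.sqrt (gaussWeight b ξ) * ‖expTransform v ξ‖) ^ 2)
      ≤ Real.sqrt ((2 * π) ^ n) * L2 v := by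
  rw [L2, ← Real.sqrt_mul (by positivity)]
  refine Real.sqrt_le_sqrt ?_
  simp_rw [mul_pow, Real.sq_sqrt (gaussWeight_pos b _).le]
  rw [← mul_pow]
  exact integral_gaussWeight_mul_normSq_le hb hv.integrable hv.integrable_sq

end expTransform

/-- `L²` bound for the form with kernel `∫ g(ξ) e^{i ξ·(x-y)} dξ`. -/
lemma norm_integral_multiplier_le {n : ℕ} {g : Vec n → ℂ} (hg : Measurable g) {K R : ℝ}
    (hK : ∀ ξ, ‖g ξ‖ ≤ K) (hR : ∀ ξ, R < ‖ξ‖ → g ξ = 0) {v u : Vec n → ℂ}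
    (hv : BddSupp v) (hu : BddSupp u) :
    ‖∫ z : Vec n × Vec n × Vec n, g z.2.1 * phase z.2.1 z.1 z.2.2 * v z.1 * u z.2.2‖
      ≤ Real.exp 1 * (2 * π) ^ n * K * (L2 v * L2 u) := by
  have hK0 : 0 ≤ K := (norm_nonneg _).trans (hK 0)
  have hgi : Integrable g := by
    refine integrable_of_bdd_of_compact (isCompact_closedBall (0 : Vec n) R)
      hg.aestronglyMeasurable (fun x _ => hK x) (fun x hx => hR x ?_)
    simpa using hx
  have htri : Integrable (fun z : Vec n × Vec n × Vec n =>
      g z.2.1 * phase z.2.1 z.1 z.2.2 * v z.1 * u z.2.2) := by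
    refine (hv.integrable.mul_prod (hgi.mul_prod hu.integrable)).mono ?_
      (Filter.Eventually.of_forall fun z => ?_)
    · exact ((((hg.comp (measurable_fst.comp measurable_snd)).mul
        continuous_phase.measurable).mul (hv.measurable.comp measurable_fst)).mul
        (hu.measurable.comp (measurable_snd.comp measurable_snd))).aestronglyMeasurable
    · simp only [norm_mul, norm_phase]
      exact le_of_eq (by ring)
  set uc : Vec n → ℂ := fun y => (starRingEnd ℂ) (u y) with huc
  have hucB : BddSupp uc := hu.of_le (K := 1)
    (Complex.continuous_conj.measurable.comp hu.measurable) fun x => by simp [huc]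
  have hL2 : L2 uc = L2 u := by simp [L2, huc]
  have e1 : ∫ z : Vec n × Vec n × Vec n, g z.2.1 * phase z.2.1 z.1 z.2.2 * v z.1 * u z.2.2 =
      ∫ ξ, g ξ * expTransform v ξ * (starRingEnd ℂ) (expTransform uc ξ) := by
    have hs := integral_integral_swap (f := fun x (w : Vec n × Vec n) =>
      g w.1 * phase w.1 x w.2 * v x * u w.2) htri
    have hs1 := integral_prod _ htri
    simp only [Measure.volume_eq_prod] at hs hs1 ⊢
    rw [hs1, hs, integral_prod _ htri.integral_prod_right]
    refine integral_congr_ae (Filter.Eventually.of_forall fun ξ => ?_)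
    simp only
    have hU : (starRingEnd ℂ) (expTransform uc ξ) = ∫ y, phase ξ 0 y * u y := by
      rw [expTransform, ← integral_conj]
      simp [huc, conj_phase]
    rw [hU, expTransform, ← integral_const_mul]
    refine integral_congr_ae (Filter.Eventually.of_forall fun y => ?_)
    simp only
    rw [← integral_const_mul, ← integral_mul_const]
    refine integral_congr_ae (Filter.Eventually.of_forall fun x => ?_)
    simp only
    rw [phase_eq_mul ξ x y]
    ring
  set b : ℝ := 1 / (n * R ^ 2 + 1) with hbdef
  have hb : 0 < b := by positivity
  have hgw : ∀ ξ, ‖g ξ‖ ≤ K * (Real.exp 1 * gaussWeight b ξ) := by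
    intro ξ
    by_cases h : R < ‖ξ‖
    · rw [hR ξ h, norm_zero]
      have := (gaussWeight_pos b ξ).le
      positivity
    · refine (hK ξ).trans (le_mul_of_one_le_right hK0 ?_)
      rw [gaussWeight, ← Real.exp_add]
      refine Real.one_le_exp ?_
      have h1 : ∑ i, ξ i ^ 2 ≤ n * R ^ 2 := by
        have : ∀ i ∈ Finset.univ, ξ i ^ 2 ≤ R ^ 2 := fun i _ => by
          rw [← sq_abs]
          exact pow_le_pow_left₀ (abs_nonneg _) ((norm_le_pi_norm ξ i).trans (not_lt.1 h)) 2
        simpa using Finset.sum_le_card_nsmul _ _ _ this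
      have : b * ∑ i, ξ i ^ 2 ≤ 1 := by
        rw [hbdef, div_mul_eq_mul_div, div_le_one (by positivity)]
        linarith
      linarith
  have hm : ∀ {w : Vec n → ℂ}, BddSupp w →
      AEStronglyMeasurable (fun ξ => Real.sqrt (gaussWeight b ξ) * ‖expTransform w ξ‖) :=
    fun hw => ((continuous_gaussWeight b).sqrt.aestronglyMeasurable).mul
      (stronglyMeasurable_expTransform hw.measurable).norm.aestronglyMeasurable
  have hCS := integral_mul_le_sqrt_mul_sqrt
    (f := fun ξ => Real.sqrt (gaussWeight b ξ) * ‖expTransform v ξ‖)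
    (g := fun ξ => Real.sqrt (gaussWeight b ξ) * ‖expTransform uc ξ‖)
    (fun _ => by positivity) (fun _ => by positivity) (hm hv) (hm hucB)
    (integrable_gaussWeight_mul_expTransform_sq hb hv.measurable)
    (integrable_gaussWeight_mul_expTransform_sq hb hucB.measurable)
  have hprod_int : Integrable (fun ξ => (Real.sqrt (gaussWeight b ξ) * ‖expTransform v ξ‖) *
      (Real.sqrt (gaussWeight b ξ) * ‖expTransform uc ξ‖)) :=
    MemLp.integrable_mul
      ((memLp_two_iff_integrable_sq (hm hv)).2
        (integrable_gaussWeight_mul_expTransform_sq hb hv.measurable))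
      ((memLp_two_iff_integrable_sq (hm hucB)).2
        (integrable_gaussWeight_mul_expTransform_sq hb hucB.measurable))
  rw [e1]
  calc _ ≤ ∫ ξ, K * Real.exp 1 * ((Real.sqrt (gaussWeight b ξ) * ‖expTransform v ξ‖) *
      (Real.sqrt (gaussWeight b ξ) * ‖expTransform uc ξ‖)) := by
        refine norm_integral_le_of_norm_le (hprod_int.const_mul _)
          (Filter.Eventually.of_forall fun ξ => ?_)
        rw [norm_mul, norm_mul, RCLike.norm_conj]
        have h1 := Real.mul_self_sqrt (gaussWeight_pos b ξ).le
        calc _ ≤ K * (Real.exp 1 * gaussWeight b ξ) * ‖expTransform v ξ‖ * ‖expTransform uc ξ‖ := by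
              gcongr; exact hgw ξ
          _ = _ := by nth_rw 1 [← h1]; ring
    _ ≤ K * Real.exp 1 * ((Real.sqrt ((2 * π) ^ n) * L2 v) * (Real.sqrt ((2 * π) ^ n) * L2 u)) := by
        rw [integral_const_mul]
        refine mul_le_mul_of_nonneg_left (hCS.trans ?_) (by positivity)
        rw [← hL2]
        exact mul_le_mul (sqrt_integral_gaussWeight_mul_expTransform_le hb hv)
          (sqrt_integral_gaussWeight_mul_expTransform_le hb hucB) (Real.sqrt_nonneg _)
          (mul_nonneg (Real.sqrt_nonneg _) (L2_nonneg _))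
    _ = _ := by
        have h1 : Real.sqrt ((2 * π) ^ n) * Real.sqrt ((2 * π) ^ n) = (2 * π) ^ n :=
          Real.mul_self_sqrt (by positivity)
        linear_combination K * Real.exp 1 * L2 v * L2 u * h1

section mpdL

variable {n : ℕ}

/-- Iterated partial derivatives along a list of coordinates. -/
noncomputable def mpdL (l : List (Fin n)) (A : Fin n → ℕ) (f : Vec n → ℂ) : Vec n → ℂ :=
  l.foldr (fun i g => (pdC i)^[A i] g) f

lemma mpd_eq_mpdL (A : Fin n → ℕ) (f : Vec n → ℂ) : mpd A f = mpdL (List.finRange n) A f := rfl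

lemma mpdL_append_singleton (l : List (Fin n)) (i : Fin n) (A : Fin n → ℕ) (f : Vec n → ℂ) :
    mpdL (l ++ [i]) A f = mpdL l A ((pdC i)^[A i] f) := by
  simp [mpdL]

lemma mpdL_congr {l : List (Fin n)} {A B : Fin n → ℕ} (h : ∀ i ∈ l, A i = B i) (f : Vec n → ℂ) :
    mpdL l A f = mpdL l B f := by
  induction l with
  | nil => rfl
  | cons i l ih =>
    have e : ∀ C : Fin n → ℕ, mpdL (i :: l) C f = (pdC i)^[C i] (mpdL l C f) := fun _ => rfl
    rw [e, e, ih fun j hj => h j (List.mem_cons_of_mem _ hj), h i List.mem_cons_self]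

lemma mpdL_zero (l : List (Fin n)) (f : Vec n → ℂ) : mpdL l (fun _ => 0) f = f := by
  induction l with
  | nil => rfl
  | cons i l ih => exact ih

lemma mpd_zero (f : Vec n → ℂ) : mpd (fun _ => 0) f = f := mpdL_zero _ f

lemma mpd_single (j : Fin n) (k : ℕ) (f : Vec n → ℂ) :
    mpd (Pi.single j k) f = (pdC j)^[k] f := by
  have key : ∀ l : List (Fin n), l.Nodup →
      mpdL l (Pi.single j k) f = if j ∈ l then (pdC j)^[k] f else f := by
    intro l
    induction l with
    | nil => intro _; rfl
    | cons i l ih =>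
      intro hl
      rw [List.nodup_cons] at hl
      change (pdC i)^[(Pi.single j k : Fin n → ℕ) i] (mpdL l (Pi.single j k) f) = _
      rw [ih hl.2]
      by_cases hij : j = i
      · subst hij
        simp [hl.1]
      · simp [hij]
  rw [mpd_eq_mpdL, key _ (List.nodup_finRange n)]
  simp

variable {Y : Type*} [NormedAddCommGroup Y] [NormedSpace ℝ Y]

lemma contDiff_pdC {f : Vec n → Y → ℂ}
    (hf : ContDiff ℝ (⊤ : ℕ∞) fun p : Vec n × Y => f p.1 p.2) (i : Fin n) :
    ContDiff ℝ (⊤ : ℕ∞) fun p : Vec n × Y => pdC i (fun x => f x p.2) p.1 := by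
  have h : ContDiff ℝ (⊤ : ℕ∞) (Function.uncurry fun (p : Vec n × Y) (x : Vec n) => f x p.2) :=
    hf.comp (contDiff_snd.prodMk (contDiff_snd.comp contDiff_fst))
  exact ContDiff.fderiv_apply (n := (⊤ : ℕ∞)) h contDiff_fst contDiff_const (by simp)

lemma contDiff_pdC_iterate {f : Vec n → Y → ℂ}
    (hf : ContDiff ℝ (⊤ : ℕ∞) fun p : Vec n × Y => f p.1 p.2) (i : Fin n) (k : ℕ) :
    ContDiff ℝ (⊤ : ℕ∞) fun p : Vec n × Y => (pdC i)^[k] (fun x => f x p.2) p.1 := by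
  induction k with
  | zero => exact hf
  | succ k ih =>
    simp only [Function.iterate_succ_apply']
    exact contDiff_pdC (f := fun x y => (pdC i)^[k] (fun x => f x y) x) ih i

lemma contDiff_mpd {f : Vec n → Y → ℂ}
    (hf : ContDiff ℝ (⊤ : ℕ∞) fun p : Vec n × Y => f p.1 p.2) (A : Fin n → ℕ) :
    ContDiff ℝ (⊤ : ℕ∞) fun p : Vec n × Y => mpd A (fun x => f x p.2) p.1 := by
  simp only [mpd_eq_mpdL]
  induction List.finRange n with
  | nil => exact hf
  | cons i l ih =>
    exact contDiff_pdC_iterate (f := fun x y => mpdL l A (fun x => f x y) x) ih i (A i)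

end mpdL

section Separation

variable {n : ℕ} {Y : Type*} [NormedAddCommGroup Y] [NormedSpace ℝ Y] [MeasurableSpace Y]
  [BorelSpace Y] {μ : Measure Y} [IsFiniteMeasureOnCompacts μ]

lemma integrable_continuous_mul {T : Type*} [TopologicalSpace T] [T2Space T]
    [MeasurableSpace T] [BorelSpace T] {ν : Measure T}
    [IsFiniteMeasureOnCompacts ν] {S : Set T} (hS : IsCompact S) {g ω : T → ℂ}
    (hg : Continuous g) (hω : Measurable ω) {C : ℝ} (hC : ∀ z, ‖ω z‖ ≤ C)
    (h0 : ∀ z ∉ S, ω z = 0) : Integrable (fun z => g z * ω z) ν := by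
  obtain ⟨B, hB⟩ := hS.exists_bound_of_continuousOn hg.continuousOn
  refine integrable_of_bdd_of_compact hS
    (hg.measurable.mul hω).aestronglyMeasurable (C := B * C) (fun y hy => ?_)
    (fun y hy => by rw [h0 y hy, mul_zero])
  rw [norm_mul]
  exact mul_le_mul (hB y hy) (hC y) (norm_nonneg _) ((norm_nonneg _).trans (hB y hy))

/-- The point with coordinates `x i` for `i ∈ l` and `τ i` otherwise. -/
noncomputable def mixPoint (l : List (Fin n)) (τ x : Vec n) : Vec n :=
  fun i => if i ∈ l then x i else τ i

lemma mixPoint_append_singleton (l : List (Fin n)) (i : Fin n) (τ x : Vec n) :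
    mixPoint (l ++ [i]) τ x = Function.update (mixPoint l τ x) i (x i) := by
  ext k
  by_cases hk : k = i
  · subst hk; simp [mixPoint]
  · simp [mixPoint, hk]

lemma mixPoint_update {l : List (Fin n)} {i : Fin n} (hi : i ∉ l) (τ x : Vec n) (t : ℝ) :
    mixPoint l (Function.update τ i t) x = Function.update (mixPoint l τ x) i t := by
  ext k
  by_cases hk : k = i
  · subst hk; simp [mixPoint, hi]
  · simp [mixPoint, hk]

lemma continuous_mixPoint (l : List (Fin n)) :
    Continuous fun p : Vec n × Vec n => mixPoint l p.1 p.2 := by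
  refine continuous_pi fun i => ?_
  unfold mixPoint
  by_cases h : i ∈ l
  · simp only [h, if_true]; fun_prop
  · simp only [h, if_false]; fun_prop

lemma hasDerivAt_update_pdC {f : Vec n → ℂ} (hf : Differentiable ℝ f) (y : Vec n) (i : Fin n)
    (t : ℝ) : HasDerivAt (fun t => f (Function.update y i t)) (pdC i f (Function.update y i t)) t :=
  (hf _).hasFDerivAt.comp_hasDerivAt t (hasDerivAt_update y i t)

lemma continuous_pdC {f : Vec n → ℂ} (hf : ContDiff ℝ (⊤ : ℕ∞) f) (i : Fin n) :
    Continuous (pdC i f) :=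
  (hf.continuous_fderiv (by simp)).clm_apply continuous_const

lemma eq_add_setIntegral_pdC {f : Vec n → ℂ} (hf : ContDiff ℝ (⊤ : ℕ∞) f) (y : Vec n) (i : Fin n)
    {c d s : ℝ} (hc : c ≤ s) (hd : s ≤ d) :
    f (Function.update y i s) = f (Function.update y i c) +
      ∫ t in Set.Icc c d, if t ≤ s then pdC i f (Function.update y i t) else 0 := by
  have hcont : Continuous fun t => pdC i f (Function.update y i t) :=
    (continuous_pdC hf i).comp (continuous_const.update i continuous_id)
  have h := intervalIntegral.integral_eq_sub_of_hasDerivAt (a := c) (b := s)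
    (fun t _ => hasDerivAt_update_pdC (hf.differentiable (by simp)) y i t)
    (hcont.intervalIntegrable _ _)
  have h2 : ∫ t in Set.Icc c d, (if t ≤ s then pdC i f (Function.update y i t) else 0) =
      ∫ t in c..s, pdC i f (Function.update y i t) := by
    rw [intervalIntegral.integral_of_le hc, ← integral_Icc_eq_integral_Ioc,
      ← integral_indicator measurableSet_Icc, ← integral_indicator measurableSet_Icc]
    refine integral_congr_ae (Filter.Eventually.of_forall fun t => ?_)
    simp only [Set.indicator, Set.mem_Icc]
    by_cases h1 : t ≤ s
    · simp [h1, h1.trans hd]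
    · simp [h1]
  rw [h2, h]; ring

lemma norm_integral_mixPoint_le [SFinite μ] {X : Y → Vec n} (hX : Continuous X) {κ : Y → ℂ}
    (hκ : Measurable κ) {Cκ : ℝ} (hCκ : ∀ z, ‖κ z‖ ≤ Cκ) {S : Set Y} (hS : IsCompact S)
    (hκS : ∀ z ∉ S, κ z = 0) {c d δ : Vec n} (hcd : c ≤ d) (hδ : ∀ i, 0 < δ i)
    (hdc : ∀ i, d i - c i ≤ δ i) (l : List (Fin n)) (hl : l.Nodup) :
    ∀ (f : Vec n → Y → ℂ), (ContDiff ℝ (⊤ : ℕ∞) fun p : Vec n × Y => f p.1 p.2) →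
    ∀ (v : Vec n → ℂ), Measurable v → (∃ C, ∀ x, ‖v x‖ ≤ C) → (∀ x, v x ≠ 0 → c ≤ x ∧ x ≤ d) →
    ∀ K : ℝ, (∀ A : Fin n → ℕ, (∀ i, A i ≤ 1) → ∀ τ, c ≤ τ → τ ≤ d → ∀ v' : Vec n → ℂ,
      Measurable v' → (∀ x, ‖v' x‖ ≤ ‖v x‖) →
      ‖∫ z, mpdL l A (fun x => f x z) τ * (v' (X z) * κ z) ∂μ‖ *
        (l.map fun i => δ i ^ A i).prod ≤ K) →
    ∀ τ, c ≤ τ → τ ≤ d → ‖∫ z, f (mixPoint l τ (X z)) z * (v (X z) * κ z) ∂μ‖ ≤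
      2 ^ l.length * K := by
  induction l using List.reverseRecOn with
  | nil =>
    intro f _ v hv _ _ K hK τ hc hd
    have hnil : ∀ x, mixPoint [] τ x = τ := fun x => by ext; simp [mixPoint]
    simpa [mpdL, hnil] using hK (fun _ => 0) (fun _ => zero_le_one) τ hc hd v hv (fun _ => le_rfl)
  | append_singleton l i ih =>
    have hil : i ∉ l := by
      rw [List.nodup_append] at hl
      exact fun h => hl.2.2 i h i (by simp) rfl
    replace ih := ih (hl.sublist (List.sublist_append_left l [i]))
    intro f hf v hv hvC hvcd K hK τ hcτ hτd
    obtain ⟨C, hC⟩ := hvC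
    have hfz : ∀ z, ContDiff ℝ (⊤ : ℕ∞) fun x => f x z := fun z =>
      hf.comp (contDiff_id.prodMk contDiff_const)
    have hC0 : 0 ≤ C := (norm_nonneg _).trans (hC 0)
    set τ' : ℝ → Vec n := fun t => Function.update τ i t with hτ'
    have hτ'mem : ∀ t ∈ Set.Icc (c i) (d i), c ≤ τ' t ∧ τ' t ≤ d := fun t ht => by
      refine ⟨fun k => ?_, fun k => ?_⟩ <;> by_cases hk : k = i
      · subst hk; simpa [hτ'] using ht.1
      · simpa [hτ', hk] using hcτ k
      · subst hk; simpa [hτ'] using ht.2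
      · simpa [hτ', hk] using hτd k
    set vt : ℝ → Vec n → ℂ := fun t x => if t ≤ x i then v x else 0 with hvt
    have hvtle : ∀ t x, ‖vt t x‖ ≤ ‖v x‖ := fun t x => by
      simp only [hvt]; split_ifs <;> simp
    -- pointwise decomposition
    have hpt : ∀ z, f (mixPoint (l ++ [i]) τ (X z)) z * (v (X z) * κ z) =
        f (mixPoint l (τ' (c i)) (X z)) z * (v (X z) * κ z) +
        ∫ t in Set.Icc (c i) (d i), pdC i (fun x => f x z) (mixPoint l (τ' t) (X z)) *
          (vt t (X z) * κ z) := by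
      intro z
      by_cases h0 : v (X z) = 0
      · have : ∀ t, vt t (X z) = 0 := fun t => by simp [hvt, h0]
        simp [h0, this]
      · obtain ⟨h1, h2⟩ := hvcd _ h0
        rw [mixPoint_append_singleton, eq_add_setIntegral_pdC (hfz z) _ i (h1 i) (h2 i), add_mul,
          ← integral_mul_const, mixPoint_update hil]
        congr 1
        refine integral_congr_ae (Filter.Eventually.of_forall fun t => ?_)
        simp only [hτ', hvt, mixPoint_update hil]
        split_ifs <;> simp
    have hmix : ∀ t, Continuous fun z => mixPoint l (τ' t) (X z) := fun t =>
      (continuous_mixPoint l).comp (continuous_const.prodMk hX)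
    have hI1 : Integrable (fun z => f (mixPoint l (τ' (c i)) (X z)) z * (v (X z) * κ z)) μ := by
      refine integrable_continuous_mul hS (C := C * Cκ) ?_ ((hv.comp hX.measurable).mul hκ)
        (fun z => ?_) (fun z hz => by simp [hκS z hz])
      · exact hf.continuous.comp ((hmix _).prodMk continuous_id)
      · rw [norm_mul]
        exact mul_le_mul (hC _) (hCκ z) (norm_nonneg _) hC0
    have hpd := contDiff_pdC hf i
    have hI2 : Integrable (fun p : Y × ℝ =>
        pdC i (fun x => f x p.1) (mixPoint l (τ' p.2) (X p.1)) * (vt p.2 (X p.1) * κ p.1))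
        (μ.prod (volume.restrict (Set.Icc (c i) (d i)))) := by
      have hmeas : Measurable fun p : Y × ℝ => vt p.2 (X p.1) * κ p.1 := by
        refine Measurable.mul ?_ (hκ.comp measurable_fst)
        refine Measurable.ite ?_ (hv.comp (hX.measurable.comp measurable_fst)) measurable_const
        exact measurableSet_le measurable_snd
          ((measurable_pi_apply i).comp (hX.measurable.comp measurable_fst))
      have := integrable_continuous_mul (ν := μ.prod volume)
        (hS.prod (isCompact_Icc (a := c i) (b := d i)))
        (g := fun p : Y × ℝ => pdC i (fun x => f x p.1) (mixPoint l (τ' p.2) (X p.1)))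
        (ω := fun p => (S ×ˢ Set.Icc (c i) (d i)).indicator
          (fun p : Y × ℝ => vt p.2 (X p.1) * κ p.1) p) (C := C * Cκ) ?_
        (hmeas.indicator (hS.measurableSet.prod measurableSet_Icc)) ?_ ?_
      · rw [show μ.prod (volume.restrict (Set.Icc (c i) (d i))) =
          (μ.prod volume).restrict (Set.univ ×ˢ Set.Icc (c i) (d i)) by
            rw [← Measure.prod_restrict, Measure.restrict_univ]]
        refine this.integrableOn.congr_fun (fun p hp => ?_)
          (MeasurableSet.univ.prod measurableSet_Icc)
        by_cases hpS : p.1 ∈ S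
        · simp [Set.indicator, hpS, hp.2]
        · simp [Set.indicator, hpS, hκS _ hpS]
      · refine hpd.continuous.comp (Continuous.prodMk ?_ continuous_fst)
        refine (continuous_mixPoint l).comp (Continuous.prodMk ?_ (hX.comp continuous_fst))
        exact continuous_const.update i continuous_snd
      · intro p
        refine (norm_indicator_le_norm_self _ _).trans ?_
        rw [norm_mul]
        exact mul_le_mul ((hvtle _ _).trans (hC _)) (hCκ _) (norm_nonneg _) hC0
      · exact fun p hp => Set.indicator_of_notMem hp _
    have hT1 : ‖∫ z, f (mixPoint l (τ' (c i)) (X z)) z * (v (X z) * κ z) ∂μ‖ ≤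
        2 ^ l.length * K := by
      have hci := hτ'mem (c i) ⟨le_rfl, hcd i⟩
      refine ih f hf v hv ⟨C, hC⟩ hvcd K ?_ _ hci.1 hci.2
      intro A hA τ₁ h1 h2 v' hv' hle
      have := hK (Function.update A i 0) (fun k => by
        by_cases hk : k = i
        · subst hk; simp
        · simpa [hk] using hA k) τ₁ h1 h2 v' hv' hle
      simp only [mpdL_append_singleton, Function.update_self, Function.iterate_zero, id] at this
      simp only [fun z => mpdL_congr (l := l) (A := Function.update A i 0) (B := A)
        (fun k hk => by simp [show k ≠ i by rintro rfl; exact hil hk]) (fun x => f x z)] at this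
      have hmap : l.map (fun k => δ k ^ Function.update A i 0 k) = l.map fun k => δ k ^ A k :=
        List.map_congr_left fun k hk => by simp [show k ≠ i by rintro rfl; exact hil hk]
      simpa [hmap] using this
    have hT2 : ∀ t ∈ Set.Icc (c i) (d i), ‖∫ z, pdC i (fun x => f x z)
        (mixPoint l (τ' t) (X z)) * (vt t (X z) * κ z) ∂μ‖ ≤ 2 ^ l.length * (K / δ i) := by
      intro t ht
      have hm : Measurable (vt t) :=
        Measurable.ite (measurableSet_le measurable_const (measurable_pi_apply i)) hv
          measurable_const
      refine ih (fun x z => pdC i (fun x => f x z) x) hpd (vt t) hm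
        ⟨C, fun x => (hvtle t x).trans (hC x)⟩ (fun x hx => hvcd x ?_) (K / δ i) ?_ _
        (hτ'mem t ht).1 (hτ'mem t ht).2
      · intro h; exact hx (by simp [hvt, h])
      intro A hA τ₁ h1 h2 v' hv' hle
      have := hK (Function.update A i 1) (fun k => by
        by_cases hk : k = i
        · subst hk; simp
        · simpa [hk] using hA k) τ₁ h1 h2 v' hv' (fun x => (hle x).trans (hvtle t x))
      simp only [mpdL_append_singleton, Function.update_self, Function.iterate_one] at this
      simp only [fun z => mpdL_congr (l := l) (A := Function.update A i 1) (B := A)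
        (fun k hk => by simp [show k ≠ i by rintro rfl; exact hil hk])
        (pdC i fun x => f x z)] at this
      have hmap : l.map (fun k => δ k ^ Function.update A i 1 k) = l.map fun k => δ k ^ A k :=
        List.map_congr_left fun k hk => by simp [show k ≠ i by rintro rfl; exact hil hk]
      simp only [List.map_append, hmap, List.prod_append, List.map_cons, List.map_nil,
        Function.update_self, pow_one, List.prod_cons, List.prod_nil, mul_one] at this
      rw [le_div_iff₀ (hδ i), mul_assoc]
      exact this
    have hK0 : 0 ≤ 2 ^ l.length * (K / δ i) :=
      (norm_nonneg _).trans (hT2 (c i) ⟨le_rfl, hcd i⟩)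
    calc _ = ‖(∫ z, f (mixPoint l (τ' (c i)) (X z)) z * (v (X z) * κ z) ∂μ) +
          ∫ t in Set.Icc (c i) (d i), ∫ z, pdC i (fun x => f x z) (mixPoint l (τ' t) (X z)) *
            (vt t (X z) * κ z) ∂μ‖ := by
          rw [← integral_integral_swap hI2, ← integral_add hI1 hI2.integral_prod_left]
          exact congrArg _ (integral_congr_ae (Filter.Eventually.of_forall hpt))
      _ ≤ 2 ^ l.length * K + 2 ^ l.length * (K / δ i) * (d i - c i) := by
          refine (norm_add_le _ _).trans (add_le_add hT1 ?_)
          have := norm_setIntegral_le_of_norm_le_const (μ := volume)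
            (s := Set.Icc (c i) (d i)) (by simp) hT2
          simpa [Real.volume_real_Icc_of_le (hcd i)] using this
      _ ≤ 2 ^ l.length * K + 2 ^ l.length * (K / δ i) * δ i := by
          gcongr
          exact hdc i
      _ = _ := by
          have := (hδ i).ne'
          rw [List.length_append, List.length_singleton, pow_succ]
          field_simp
          ring

end Separation

section Form

variable {n : ℕ}

/-- The sesquilinear form with amplitude `χ(ξ) H(x, hξ)`. -/
noncomputable def ampForm (h : ℝ) (χ : Vec n → ℂ) (H : Vec n → Vec n → ℂ) (v u : Vec n → ℂ) : ℂ :=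
  ∫ z : Vec n × Vec n × Vec n,
    χ z.2.1 * H z.1 (h • z.2.1) * phase z.2.1 z.1 z.2.2 * v z.1 * u z.2.2

/-- The sesquilinear form with amplitude `χ(ξ) F(x, hξ, y)`. -/
noncomputable def biForm (h : ℝ) (χ : Vec n → ℂ) (F : Vec n → Vec n → Vec n → ℂ)
    (v u : Vec n → ℂ) : ℂ :=
  ∫ z : Vec n × Vec n × Vec n,
    χ z.2.1 * F z.1 (h • z.2.1) z.2.2 * phase z.2.1 z.1 z.2.2 * v z.1 * u z.2.2

lemma integrable_biForm {h R : ℝ} {χ : Vec n → ℂ} (hχ : Continuous χ)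
    (hχ0 : ∀ ξ, R < ‖ξ‖ → χ ξ = 0) {F : Vec n → Vec n → Vec n → ℂ}
    (hF : Continuous fun z : Vec n × Vec n × Vec n => F z.1 z.2.1 z.2.2)
    {v u : Vec n → ℂ} (hv : BddSupp v) (hu : BddSupp u) :
    Integrable fun z : Vec n × Vec n × Vec n =>
      χ z.2.1 * F z.1 (h • z.2.1) z.2.2 * phase z.2.1 z.1 z.2.2 * v z.1 * u z.2.2 := by
  obtain ⟨Cv, Rv, hv'⟩ := hv.exists_bound
  obtain ⟨Cu, Ru, hu'⟩ := hu.exists_bound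
  have hCv : 0 ≤ Cv := (norm_nonneg _).trans (hv' 0).1
  set B : Set (Vec n) := Metric.closedBall 0 R
  have := integrable_continuous_mul (ν := (volume : Measure (Vec n × Vec n × Vec n)))
    ((isCompact_closedBall (0 : Vec n) Rv).prod
      ((isCompact_closedBall (0 : Vec n) R).prod (isCompact_closedBall (0 : Vec n) Ru)))
    (g := fun z => χ z.2.1 * F z.1 (h • z.2.1) z.2.2 * phase z.2.1 z.1 z.2.2)
    (ω := fun z => B.indicator (fun _ => v z.1 * u z.2.2) z.2.1) (C := Cv * Cu) ?_ ?_ ?_ ?_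
  · refine this.congr (Filter.Eventually.of_forall fun z => ?_)
    by_cases hz : z.2.1 ∈ B
    · simp only [Set.indicator, hz, if_true]; ring
    · have : χ z.2.1 = 0 := hχ0 _ (by simpa [B] using hz)
      simp [this]
  · have h1 : Continuous fun z : Vec n × Vec n × Vec n => F z.1 (h • z.2.1) z.2.2 :=
      hF.comp (continuous_fst.prodMk (((continuous_fst.comp continuous_snd).const_smul h).prodMk
        (continuous_snd.comp continuous_snd)))
    exact ((hχ.comp (continuous_fst.comp continuous_snd)).mul h1).mul continuous_phase
  · have : (fun z : Vec n × Vec n × Vec n => B.indicator (fun _ => v z.1 * u z.2.2) z.2.1) =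
        (Prod.snd ⁻¹' (Prod.fst ⁻¹' B)).indicator fun z => v z.1 * u z.2.2 := by
      ext z; simp [Set.indicator]
    rw [this]
    exact ((hv.measurable.comp measurable_fst).mul
      (hu.measurable.comp (measurable_snd.comp measurable_snd))).indicator
      (measurable_snd (measurable_fst Metric.isClosed_closedBall.measurableSet))
  · intro z
    refine (norm_indicator_le_norm_self _ _).trans ?_
    rw [norm_mul]
    exact mul_le_mul (hv' _).1 (hu' _).1 (norm_nonneg _) hCv
  · rintro ⟨x, ξ, y⟩ hz
    simp only [Set.mem_prod, mem_closedBall_zero_iff, not_and_or, not_le] at hz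
    rcases hz with hz | hz | hz
    · simp [(hv' x).2 hz]
    · exact Set.indicator_of_notMem (by simpa [B] using hz) _
    · simp [(hu' y).2 hz]

lemma integrable_ampForm {h R : ℝ} {χ : Vec n → ℂ} (hχ : Continuous χ)
    (hχ0 : ∀ ξ, R < ‖ξ‖ → χ ξ = 0) {H : Vec n → Vec n → ℂ}
    (hH : ContDiff ℝ (⊤ : ℕ∞) fun p : Vec n × Vec n => H p.1 p.2)
    {v u : Vec n → ℂ} (hv : BddSupp v) (hu : BddSupp u) :
    Integrable fun z : Vec n × Vec n × Vec n =>
      χ z.2.1 * H z.1 (h • z.2.1) * phase z.2.1 z.1 z.2.2 * v z.1 * u z.2.2 :=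
  integrable_biForm (F := fun x ξ _ => H x ξ) hχ hχ0
    (hH.continuous.comp (continuous_fst.prodMk (continuous_fst.comp continuous_snd))) hv hu

lemma BddSupp.indicator {v : Vec n → ℂ} (hv : BddSupp v) {S : Set (Vec n)}
    (hS : MeasurableSet S) : BddSupp (S.indicator v) :=
  hv.of_le (hv.measurable.indicator hS) (K := 1) fun x => by
    rw [one_mul]; exact norm_indicator_le_norm_self _ _

/-- The constant in the `L²` bound for Fourier multipliers. -/
noncomputable def multConst (n : ℕ) : ℝ := Real.exp 1 * (2 * π) ^ n

lemma multConst_pos (n : ℕ) : 0 < multConst n := by unfold multConst; positivity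

lemma norm_ampForm_le {h R A K : ℝ} {χ : Vec n → ℂ} (hχ : Continuous χ)
    (hχ0 : ∀ ξ, R < ‖ξ‖ → χ ξ = 0) (hA : ∀ ξ, ‖χ ξ‖ ≤ A) {H : Vec n → Vec n → ℂ}
    (hH : ContDiff ℝ (⊤ : ℕ∞) fun p : Vec n × Vec n => H p.1 p.2) {c d δ : Vec n} (hcd : c ≤ d)
    (hδ : ∀ i, 0 < δ i) (hdc : ∀ i, d i - c i ≤ δ i)
    (hK : ∀ A' : Fin n → ℕ, (∀ i, A' i ≤ 1) → ∀ x, c ≤ x → x ≤ d → ∀ ξ,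
      ‖mpd A' (fun x => H x ξ) x‖ * ∏ i, δ i ^ A' i ≤ K)
    {v u : Vec n → ℂ} (hv : BddSupp v) (hvcd : ∀ x, v x ≠ 0 → c ≤ x ∧ x ≤ d) (hu : BddSupp u) :
    ‖ampForm h χ H v u‖ ≤ 2 ^ n * (multConst n * (A * K) * (L2 v * L2 u)) := by
  have hA0 : 0 ≤ A := (norm_nonneg _).trans (hA 0)
  obtain ⟨Cv, Rv, hv'⟩ := hv.exists_bound
  obtain ⟨Cu, Ru, hu'⟩ := hu.exists_bound
  set I : Set (Vec n) := Set.Icc c d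
  set κ : Vec n × Vec n × Vec n → ℂ := fun z =>
    I.indicator 1 z.1 * (χ z.2.1 * phase z.2.1 z.1 z.2.2 * u z.2.2) with hκ
  have hκm : Measurable κ :=
    ((measurable_one.indicator measurableSet_Icc).comp measurable_fst).mul
      (((hχ.measurable.comp (measurable_fst.comp measurable_snd)).mul
        continuous_phase.measurable).mul
        (hu.measurable.comp (measurable_snd.comp measurable_snd)))
  have hind : ∀ x, ‖I.indicator (1 : Vec n → ℂ) x‖ ≤ 1 := fun x => by
    refine (norm_indicator_le_norm_self _ _).trans ?_
    simp
  have hκb : ∀ z, ‖κ z‖ ≤ A * Cu := fun z => by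
    rw [hκ, norm_mul, norm_mul, norm_mul, norm_phase, mul_one]
    calc _ ≤ 1 * (A * Cu) := by
          gcongr
          · exact hind _
          · exact hA _
          · exact (hu' _).1
      _ = _ := one_mul _
  have hκ0 : ∀ z ∉ I ×ˢ (Metric.closedBall (0 : Vec n) R ×ˢ Metric.closedBall (0 : Vec n) Ru),
      κ z = 0 := by
    rintro ⟨x, ξ, y⟩ hz
    simp only [Set.mem_prod, mem_closedBall_zero_iff, not_and_or, not_le] at hz
    rcases hz with hz | hz | hz
    · simp [hκ, hz]
    · simp [hκ, hχ0 _ hz]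
    · simp [hκ, (hu' y).2 hz]
  have hmain := norm_integral_mixPoint_le (μ := (volume : Measure (Vec n × Vec n × Vec n)))
    (X := Prod.fst) continuous_fst hκm hκb
    (isCompact_Icc.prod ((isCompact_closedBall _ _).prod (isCompact_closedBall _ _))) hκ0
    hcd hδ hdc (List.finRange n) (List.nodup_finRange n) (fun x z => H x (h • z.2.1))
    (hH.comp (contDiff_fst.prodMk
      ((contDiff_fst.comp (contDiff_snd.comp contDiff_snd)).const_smul h)))
    v hv.measurable ⟨Cv, fun x => (hv' x).1⟩ hvcd (multConst n * (A * K) * (L2 v * L2 u)) ?_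
    c le_rfl hcd
  · have hmp : ∀ x, mixPoint (List.finRange n) c x = x := fun x => by ext i; simp [mixPoint]
    simp only [hmp, List.length_finRange] at hmain
    refine (le_of_eq ?_).trans hmain
    congr 1
    refine integral_congr_ae (Filter.Eventually.of_forall fun z => ?_)
    simp only [hκ]
    by_cases h0 : v z.1 = 0
    · simp [h0]
    · have : z.1 ∈ I := hvcd _ h0
      simp only [Set.indicator, this, if_true, Pi.one_apply]; ring
  · intro A' hA' τ h1 h2 v' hv'm hle
    set P : ℝ := ∏ i, δ i ^ A' i
    have hP : 0 < P := Finset.prod_pos fun i _ => pow_pos (hδ i) _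
    rw [← Fin.prod_univ_def]
    have hB : BddSupp v' := hv.of_le hv'm (K := 1) (by simpa using hle)
    have hmp : Continuous fun ξ => mpd A' (fun x => H x ξ) τ :=
      (contDiff_mpd hH A').continuous.comp (continuous_const.prodMk continuous_id)
    have hg : Continuous fun ξ => χ ξ * mpd A' (fun x => H x (h • ξ)) τ :=
      hχ.mul (hmp.comp (continuous_const_smul h))
    have key := norm_integral_multiplier_le (K := A * (K / P)) (R := R) hg.measurable (fun ξ => by
        rw [norm_mul]
        gcongr
        · exact hA ξ
        · rw [le_div_iff₀ hP]; exact hK A' hA' τ h1 h2 _)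
      (fun ξ hξ => by simp [hχ0 ξ hξ]) (hB.indicator (S := I) measurableSet_Icc) hu
    have hL : L2 (I.indicator v') ≤ L2 v := by
      have := hv.L2_le (u := I.indicator v') (K := 1) zero_le_one (fun x => by
        rw [one_mul]; exact (norm_indicator_le_norm_self _ _).trans (hle x))
      simpa using this
    have e : ∫ z : Vec n × Vec n × Vec n, mpdL (List.finRange n) A' (fun x => H x (h • z.2.1)) τ *
        (v' z.1 * κ z) = ∫ z : Vec n × Vec n × Vec n,
          χ z.2.1 * mpd A' (fun x => H x (h • z.2.1)) τ * phase z.2.1 z.1 z.2.2 *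
            I.indicator v' z.1 * u z.2.2 := by
      refine integral_congr_ae (Filter.Eventually.of_forall fun z => ?_)
      simp only [hκ, ← mpd_eq_mpdL]
      by_cases hz : z.1 ∈ I
      · simp only [Set.indicator, hz, if_true, Pi.one_apply]; ring
      · simp [Set.indicator, hz]
    rw [e]
    have hKP : 0 ≤ A * (K / P) := by
      refine mul_nonneg hA0 ((norm_nonneg (mpd A' (fun x => H x 0) τ)).trans ?_)
      rw [le_div_iff₀ hP]; exact hK A' hA' τ h1 h2 _
    calc _ ≤ (Real.exp 1 * (2 * π) ^ n * (A * (K / P)) * (L2 v * L2 u)) * P := by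
          refine mul_le_mul_of_nonneg_right (key.trans ?_) hP.le
          have := L2_nonneg u
          gcongr
      _ = _ := by
          rw [multConst]
          field_simp

lemma pdC_eq_zero_of_norm_lt {χ : Vec n → ℂ} {R : ℝ} (hχ0 : ∀ ξ, R < ‖ξ‖ → χ ξ = 0) (j : Fin n)
    (ξ : Vec n) (hξ : R < ‖ξ‖) : pdC j χ ξ = 0 := by
  have : χ =ᶠ[nhds ξ] fun _ => 0 := by
    filter_upwards [(isOpen_lt continuous_const continuous_norm).mem_nhds hξ] with η hη
      using hχ0 η hη
  rw [pdC, this.fderiv_eq]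
  simp

lemma contDiff_pdC_const {χ : Vec n → ℂ} (hχ : ContDiff ℝ (⊤ : ℕ∞) χ) (j : Fin n) :
    ContDiff ℝ (⊤ : ℕ∞) (pdC j χ) :=
  (contDiff_pdC (Y := ℝ) (f := fun x _ => χ x) (hχ.comp contDiff_fst) j).comp
    (contDiff_id.prodMk (contDiff_const (c := (0 : ℝ))))

lemma contDiff_pdC_snd {H : Vec n → Vec n → ℂ}
    (hH : ContDiff ℝ (⊤ : ℕ∞) fun p : Vec n × Vec n => H p.1 p.2) (j : Fin n) :
    ContDiff ℝ (⊤ : ℕ∞) fun p : Vec n × Vec n => pdC j (H p.1) p.2 :=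
  (contDiff_pdC (f := fun ξ x => H x ξ) (hH.comp (contDiff_snd.prodMk contDiff_fst)) j).comp
    (contDiff_snd.prodMk contDiff_fst)

lemma hasDerivAt_line_pdC {χ : Vec n → ℂ} (hχ : Differentiable ℝ χ) (ξ : Vec n) (j : Fin n) (h : ℝ) :
    HasDerivAt (fun t : ℝ => χ (h • (ξ + t • Pi.single j 1))) (h * pdC j χ (h • ξ)) 0 := by
  have h1 : HasDerivAt (fun t : ℝ => h • (ξ + t • (Pi.single j 1 : Vec n)))
      (h • (Pi.single j 1 : Vec n)) 0 := by
    have := (((hasDerivAt_id (0 : ℝ)).smul_const (Pi.single j 1 : Vec n)).const_add ξ).const_smul h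
    rw [one_smul] at this
    exact this
  have h2 := (hχ (h • (ξ + (0 : ℝ) • (Pi.single j 1 : Vec n)))).hasFDerivAt.comp_hasDerivAt 0 h1
  simp only [zero_smul, add_zero, map_smul] at h2
  rw [← Complex.real_smul]
  exact h2

lemma ampForm_commutator {h R : ℝ} {χ : Vec n → ℂ} (hχ : ContDiff ℝ (⊤ : ℕ∞) χ)
    (hχ0 : ∀ ξ, R < ‖ξ‖ → χ ξ = 0) {H : Vec n → Vec n → ℂ}
    (hH : ContDiff ℝ (⊤ : ℕ∞) fun p : Vec n × Vec n => H p.1 p.2)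
    {v u : Vec n → ℂ} (hv : BddSupp v) (hu : BddSupp u) (j : Fin n) (p p' : ℝ)
    (hv1 : BddSupp fun x => ((x j - p : ℝ) : ℂ) * v x)
    (hu1 : BddSupp fun y => ((y j - p' : ℝ) : ℂ) * u y) :
    Complex.I * ((p - p' : ℝ) : ℂ) * ampForm h χ H v u =
      -(ampForm h (pdC j χ) H v u + h * ampForm h χ (fun x => pdC j (H x)) v u)
      - Complex.I * ampForm h χ H (fun x => ((x j - p : ℝ) : ℂ) * v x) u
      + Complex.I * ampForm h χ H v (fun y => ((y j - p' : ℝ) : ℂ) * u y) := by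
  have i0 := integrable_ampForm (h := h) hχ.continuous hχ0 hH hv hu
  have i1 := integrable_ampForm (h := h) (contDiff_pdC_const hχ j).continuous
    (pdC_eq_zero_of_norm_lt hχ0 j) hH hv hu
  have i2 := integrable_ampForm (h := h) (H := fun x => pdC j (H x)) hχ.continuous hχ0 (contDiff_pdC_snd hH j) hv hu
  have i3 := integrable_ampForm (h := h) hχ.continuous hχ0 hH hv1 hu
  have i4 := integrable_ampForm (h := h) hχ.continuous hχ0 hH hv hu1
  set e : Vec n × Vec n × Vec n := (0, Pi.single j 1, 0) with he
  set G : Vec n × Vec n × Vec n → ℂ := fun z =>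
    χ z.2.1 * H z.1 (h • z.2.1) * (v z.1 * u z.2.2) with hG
  set G' : Vec n × Vec n × Vec n → ℂ := fun z =>
    (pdC j χ z.2.1 * H z.1 (h • z.2.1) + χ z.2.1 * (h * pdC j (H z.1) (h • z.2.1))) *
      (v z.1 * u z.2.2) with hG'
  set φ : Vec n × Vec n × Vec n → ℂ := fun z => phase z.2.1 z.1 z.2.2 with hφ
  set φ' : Vec n × Vec n × Vec n → ℂ := fun z =>
    Complex.I * ((z.1 j - z.2.2 j : ℝ) : ℂ) * phase z.2.1 z.1 z.2.2 with hφ'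
  have hGd : ∀ z, HasLineDerivAt ℝ G (G' z) z e := by
    intro z
    have d1 := hasDerivAt_line_pdC (hχ.differentiable (by simp)) z.2.1 j 1
    have hHz : ContDiff ℝ (⊤ : ℕ∞) (H z.1) := hH.comp (contDiff_const.prodMk contDiff_id)
    have d2 := hasDerivAt_line_pdC (hHz.differentiable (by simp)) z.2.1 j h
    have := (d1.mul d2).mul_const (v z.1 * u z.2.2)
    simp only [one_smul, Complex.ofReal_one, one_mul, zero_smul, add_zero] at this
    change HasDerivAt (fun t : ℝ => G (z + t • e)) (G' z) 0
    have hfun : (fun t : ℝ => G (z + t • e)) = fun t : ℝ => χ (z.2.1 + t • Pi.single j 1) *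
        H z.1 (h • (z.2.1 + t • Pi.single j 1)) * (v z.1 * u z.2.2) := by
      funext t; simp [hG, he]
    rw [hfun]
    exact this
  have hφd : ∀ z, HasLineDerivAt ℝ φ (φ' z) z e := by
    intro z
    change HasDerivAt (fun t : ℝ => φ (z + t • e)) (φ' z) 0
    have h1 : HasDerivAt (fun t : ℝ => ∑ i, (z.2.1 + t • (Pi.single j 1 : Vec n)) i *
        (z.1 i - z.2.2 i)) (z.1 j - z.2.2 j) 0 := by
      have : ∀ t : ℝ, ∑ i, (z.2.1 + t • (Pi.single j 1 : Vec n)) i * (z.1 i - z.2.2 i) =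
          (∑ i, z.2.1 i * (z.1 i - z.2.2 i)) + t * (z.1 j - z.2.2 j) := fun t => by
        simp only [Pi.add_apply, Pi.smul_apply, smul_eq_mul, add_mul, Finset.sum_add_distrib]
        congr 1
        rw [Finset.sum_eq_single j]
        · simp
        · intro b _ hb; simp [hb]
        · simp
      simp_rw [this]
      simpa using ((hasDerivAt_id (0 : ℝ)).mul_const (z.1 j - z.2.2 j)).const_add
        (∑ i, z.2.1 i * (z.1 i - z.2.2 i))
    have h2 := (h1.ofReal_comp.const_mul Complex.I).cexp
    simp only [zero_smul, add_zero] at h2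
    convert h2 using 1
    · ext t; simp [hφ, he, phase]
    · simp only [hφ', phase]; ring
  have : (volume : Measure (Vec n × Vec n)).IsAddHaarMeasure :=
    Measure.prod.instIsAddHaarMeasure _ _
  have : (volume : Measure (Vec n × Vec n × Vec n)).IsAddHaarMeasure :=
    Measure.prod.instIsAddHaarMeasure _ _
  have ib : ∫ z, G z * φ' z = -∫ z, G' z * φ z := by
    refine integral_bilinear_hasLineDerivAt_right_eq_neg_left_of_integrable
      (B := ContinuousLinearMap.mul ℝ ℂ) (v := e) ?_ ?_ ?_ (fun z _ => hGd z) (fun z _ => hφd z)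
    · refine (i1.add (i2.const_mul (h : ℂ))).congr (Filter.Eventually.of_forall fun z => ?_)
      simp only [Pi.add_apply, ContinuousLinearMap.mul_apply', hG', hφ]; ring
    · refine ((i3.sub i4).add (i0.const_mul ((p - p' : ℝ) : ℂ))).const_mul Complex.I |>.congr
        (Filter.Eventually.of_forall fun z => ?_)
      simp only [Pi.add_apply, Pi.sub_apply, ContinuousLinearMap.mul_apply', hG, hφ']
      push_cast; ring
    · refine i0.congr (Filter.Eventually.of_forall fun z => ?_)
      simp only [ContinuousLinearMap.mul_apply', hG, hφ]; ring
  have e1 : ∫ z, G' z * φ z =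
      ampForm h (pdC j χ) H v u + h * ampForm h χ (fun x => pdC j (H x)) v u := by
    rw [ampForm, ampForm, ← integral_const_mul, ← integral_add i1 (i2.const_mul _)]
    refine integral_congr_ae (Filter.Eventually.of_forall fun z => ?_)
    simp only [hG', hφ]; ring
  have e2 : ∫ z, G z * φ' z = Complex.I * ((p - p' : ℝ) : ℂ) * ampForm h χ H v u +
      Complex.I * ampForm h χ H (fun x => ((x j - p : ℝ) : ℂ) * v x) u -
      Complex.I * ampForm h χ H v (fun y => ((y j - p' : ℝ) : ℂ) * u y) := by
    have hI := integral_sub ((i0.const_mul (Complex.I * ((p - p' : ℝ) : ℂ))).add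
      (i3.const_mul Complex.I)) (i4.const_mul Complex.I)
    simp only [Pi.add_apply] at hI
    rw [ampForm, ampForm, ampForm, ← integral_const_mul, ← integral_const_mul,
      ← integral_const_mul, ← integral_add (i0.const_mul _) (i3.const_mul _), ← hI]
    refine integral_congr_ae (Filter.Eventually.of_forall fun z => ?_)
    simp only [hG, hφ']; push_cast; ring
  rw [← e1, ← ib, e2]; ring

end Form

section Decay

variable {n : ℕ}

lemma BddSupp.coord_mul {v : Vec n → ℂ} (hv : BddSupp v) {j : Fin n} {p s : ℝ}
    (h : ∀ x, v x ≠ 0 → |x j - p| ≤ s) (hs : 0 ≤ s) :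
    BddSupp (fun x => ((x j - p : ℝ) : ℂ) * v x) ∧
      L2 (fun x => ((x j - p : ℝ) : ℂ) * v x) ≤ s * L2 v := by
  have hb : ∀ x, ‖((x j - p : ℝ) : ℂ) * v x‖ ≤ s * ‖v x‖ := fun x => by
    by_cases h0 : v x = 0
    · simp [h0]
    · rw [norm_mul, Complex.norm_real, Real.norm_eq_abs]
      exact mul_le_mul_of_nonneg_right (h x h0) (norm_nonneg _)
  refine ⟨hv.of_le ?_ hb, hv.L2_le hs hb⟩
  exact (Complex.measurable_ofReal.comp
    ((measurable_pi_apply j).sub measurable_const)).mul hv.measurable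

lemma pow_mul_norm_ampForm_le {h R : ℝ} (hh : 0 < h) {c d δ : Vec n} (hcd : c ≤ d)
    (hδ : ∀ i, 0 < δ i) (hdc : ∀ i, d i - c i ≤ δ i) (j : Fin n) (p p' : ℝ) (N : ℕ) :
    ∀ (A K V U : ℝ) (χ : Vec n → ℂ) (H : Vec n → Vec n → ℂ) (v u : Vec n → ℂ),
    ContDiff ℝ (⊤ : ℕ∞) χ → (∀ ξ, R < ‖ξ‖ → χ ξ = 0) →
    (∀ i ≤ N, ∀ ξ, ‖(pdC j)^[i] χ ξ‖ ≤ A * δ j ^ i) →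
    (ContDiff ℝ (⊤ : ℕ∞) fun p : Vec n × Vec n => H p.1 p.2) →
    (∀ i ≤ N, ∀ A' : Fin n → ℕ, (∀ i, A' i ≤ 1) → ∀ x, c ≤ x → x ≤ d → ∀ ξ,
      h ^ i * ‖mpd A' (fun x => (pdC j)^[i] (H x) ξ) x‖ * ∏ i, δ i ^ A' i ≤ K * δ j ^ i) →
    BddSupp v → (∀ x, v x ≠ 0 → c ≤ x ∧ x ≤ d) → (∀ x, v x ≠ 0 → |x j - p| ≤ δ j) → L2 v ≤ V →
    BddSupp u → (∀ x, u x ≠ 0 → |x j - p'| ≤ δ j) → L2 u ≤ U →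
    |p - p'| ^ N * ‖ampForm h χ H v u‖ ≤
      (4 * δ j) ^ N * (2 ^ n * (multConst n * (A * K) * (V * U))) := by
  induction N with
  | zero =>
    intro A K V U χ H v u hχ hχ0 hA hH hK hv hvcd _ hV hu _ hU
    have hA' := fun ξ => hA 0 le_rfl ξ
    have hK' := hK 0 le_rfl
    simp only [Function.iterate_zero, id, pow_zero, mul_one, one_mul] at hA' hK' ⊢
    refine (norm_ampForm_le hχ.continuous hχ0 hA' hH hcd hδ hdc hK' hv hvcd hu).trans ?_
    have hA0 : 0 ≤ A := (norm_nonneg _).trans (hA' 0)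
    have hK0 : 0 ≤ K := le_trans
      (mul_nonneg (norm_nonneg _) (Finset.prod_nonneg fun i _ => pow_nonneg (hδ i).le _))
      (hK' (fun _ => 0) (fun _ => zero_le_one) c le_rfl hcd 0)
    have := L2_nonneg u
    have := (L2_nonneg v).trans hV
    have := (multConst_pos n).le
    gcongr
  | succ N ih =>
    intro A K V U χ H v u hχ hχ0 hA hH hK hv hvcd hvp hV hu hup hU
    set s := δ j with hs
    have hs0 : 0 < s := hδ j
    obtain ⟨hv1, hv1L⟩ := hv.coord_mul hvp hs0.le
    obtain ⟨hu1, hu1L⟩ := hu.coord_mul hup hs0.le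
    have hcomm := ampForm_commutator (h := h) hχ hχ0 hH hv hu j p p' hv1 hu1
    set X : ℝ := 2 ^ n * (multConst n * (A * K) * (V * U)) with hX
    have b1 := ih (A * s) K V U (pdC j χ) H v u (contDiff_pdC_const hχ j)
      (pdC_eq_zero_of_norm_lt hχ0 j) (fun i hi ξ => by
        have := hA (i + 1) (by omega) ξ
        rw [Function.iterate_succ_apply] at this
        rw [mul_assoc, ← pow_succ']; exact this)
      hH (fun i hi => hK i (by omega)) hv hvcd hvp hV hu hup hU
    have b2 := ih A (K * s / h) V U χ (fun x => pdC j (H x)) v u hχ hχ0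
      (fun i hi => hA i (by omega)) (contDiff_pdC_snd hH j) (fun i hi A' hA' x h1 h2 ξ => by
        have := hK (i + 1) (by omega) A' hA' x h1 h2 ξ
        simp only [Function.iterate_succ_apply] at this
        rw [div_mul_eq_mul_div, le_div_iff₀ hh]
        calc _ = _ := by ring
          _ ≤ _ := this
          _ = _ := by ring) hv hvcd hvp hV hu hup hU
    have b3 := ih A K (s * V) U χ H _ u hχ hχ0 (fun i hi => hA i (by omega)) hH
      (fun i hi => hK i (by omega)) hv1 (fun x hx => hvcd x (right_ne_zero_of_mul hx))
      (fun x hx => hvp x (right_ne_zero_of_mul hx))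
      (hv1L.trans (mul_le_mul_of_nonneg_left hV hs0.le)) hu hup hU
    have b4 := ih A K V (s * U) χ H v _ hχ hχ0 (fun i hi => hA i (by omega)) hH
      (fun i hi => hK i (by omega)) hv hvcd hvp hV hu1
      (fun x hx => hup x (right_ne_zero_of_mul hx))
      (hu1L.trans (mul_le_mul_of_nonneg_left hU hs0.le))
    have hn : |p - p'| * ‖ampForm h χ H v u‖ ≤ ‖ampForm h (pdC j χ) H v u‖ +
        h * ‖ampForm h χ (fun x => pdC j (H x)) v u‖ +
        ‖ampForm h χ H (fun x => ((x j - p : ℝ) : ℂ) * v x) u‖ +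
        ‖ampForm h χ H v (fun y => ((y j - p' : ℝ) : ℂ) * u y)‖ := by
      have h1 := congrArg norm hcomm
      rw [norm_mul, norm_mul, Complex.norm_I, one_mul, Complex.norm_real,
        Real.norm_eq_abs] at h1
      rw [h1]
      refine (norm_add_le _ _).trans (add_le_add ((norm_sub_le _ _).trans
        (add_le_add ?_ (by simp))) (by simp))
      rw [norm_neg]
      refine (norm_add_le _ _).trans (add_le_add le_rfl ?_)
      rw [norm_mul, Complex.norm_real, Real.norm_of_nonneg hh.le]
    have e2 : h * (2 ^ n * (multConst n * (A * (K * s / h)) * (V * U))) = s * X := by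
      rw [hX]; field_simp
    calc _ = |p - p'| ^ N * (|p - p'| * ‖ampForm h χ H v u‖) := by rw [pow_succ]; ring
      _ ≤ |p - p'| ^ N * _ := mul_le_mul_of_nonneg_left hn (by positivity)
      _ = |p - p'| ^ N * ‖ampForm h (pdC j χ) H v u‖ +
          h * (|p - p'| ^ N * ‖ampForm h χ (fun x => pdC j (H x)) v u‖) +
          |p - p'| ^ N * ‖ampForm h χ H (fun x => ((x j - p : ℝ) : ℂ) * v x) u‖ +
          |p - p'| ^ N * ‖ampForm h χ H v (fun y => ((y j - p' : ℝ) : ℂ) * u y)‖ := by ring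
      _ ≤ (4 * s) ^ N * (s * X) + (4 * s) ^ N * (s * X) + (4 * s) ^ N * (s * X) +
          (4 * s) ^ N * (s * X) := by
          refine add_le_add (add_le_add (add_le_add ?_ ?_) ?_) ?_
          · refine b1.trans_eq ?_; rw [hX]; ring
          · refine (mul_le_mul_of_nonneg_left b2 hh.le).trans_eq ?_
            rw [← e2]; ring
          · refine b3.trans_eq ?_; rw [hX]; ring
          · refine b4.trans_eq ?_; rw [hX]; ring
      _ = _ := by rw [pow_succ]; ring

lemma contDiff_d3B {F : Vec n → Vec n → Vec n → ℂ}
    (hF : ContDiff ℝ (⊤ : ℕ∞) fun z : Vec n × Vec n × Vec n => F z.1 z.2.1 z.2.2)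
    (A : Fin n → ℕ) : ContDiff ℝ (⊤ : ℕ∞) fun z : Vec n × Vec n × Vec n =>
      d3B A F z.1 z.2.1 z.2.2 :=
  (contDiff_mpd (f := fun y (w : Vec n × Vec n) => F w.1 w.2 y)
    (hF.comp ((contDiff_fst.comp contDiff_snd).prodMk
      ((contDiff_snd.comp contDiff_snd).prodMk contDiff_fst))) A).comp
    ((contDiff_snd.comp contDiff_snd).prodMk
      (contDiff_fst.prodMk (contDiff_fst.comp contDiff_snd)))

lemma pow_mul_norm_biForm_le {h R : ℝ} (hh : 0 < h) {c d c' d' δ : Vec n} (hcd : c ≤ d)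
    (hcd' : c' ≤ d') (hδ : ∀ i, 0 < δ i) (hdc : ∀ i, d i - c i ≤ δ i)
    (hdc' : ∀ i, d' i - c' i ≤ δ i) (j : Fin n) (p p' : ℝ) (N : ℕ) {A K : ℝ} {χ : Vec n → ℂ}
    {F : Vec n → Vec n → Vec n → ℂ} {v u : Vec n → ℂ} (hχ : ContDiff ℝ (⊤ : ℕ∞) χ)
    (hχ0 : ∀ ξ, R < ‖ξ‖ → χ ξ = 0) (hA : ∀ i ≤ N, ∀ ξ, ‖(pdC j)^[i] χ ξ‖ ≤ A * δ j ^ i)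
    (hF : ContDiff ℝ (⊤ : ℕ∞) fun z : Vec n × Vec n × Vec n => F z.1 z.2.1 z.2.2)
    (hK : ∀ i ≤ N, ∀ A₁ : Fin n → ℕ, (∀ i, A₁ i ≤ 1) → ∀ A₃ : Fin n → ℕ, (∀ i, A₃ i ≤ 1) →
      ∀ x, c ≤ x → x ≤ d → ∀ y, c' ≤ y → y ≤ d' → ∀ ξ,
      h ^ i * ‖d1B A₁ (d2B (Pi.single j i) (d3B A₃ F)) x ξ y‖ *
        ((∏ i, δ i ^ A₁ i) * ∏ i, δ i ^ A₃ i) ≤ K * δ j ^ i)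
    (hv : BddSupp v) (hvcd : ∀ x, v x ≠ 0 → c ≤ x ∧ x ≤ d) (hvp : ∀ x, v x ≠ 0 → |x j - p| ≤ δ j)
    (hu : BddSupp u) (hucd : ∀ x, u x ≠ 0 → c' ≤ x ∧ x ≤ d')
    (hup : ∀ x, u x ≠ 0 → |x j - p'| ≤ δ j) :
    |p - p'| ^ N * ‖biForm h χ F v u‖ ≤
      (4 * δ j) ^ N * (4 ^ n * (multConst n * (A * K) * (L2 v * L2 u))) := by
  obtain ⟨Cv, Rv, hv'⟩ := hv.exists_bound
  obtain ⟨Cu, Ru, hu'⟩ := hu.exists_bound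
  have hA1 : ∀ ξ, ‖χ ξ‖ ≤ A := fun ξ => by simpa using hA 0 (Nat.zero_le _) ξ
  have hA0 : 0 ≤ A := (norm_nonneg _).trans (hA1 0)
  have hK0 : 0 ≤ K := by
    have := hK 0 (Nat.zero_le _) (fun _ => 0) (fun _ => zero_le_one) (fun _ => 0)
      (fun _ => zero_le_one) c le_rfl hcd c' le_rfl hcd' 0
    simp only [pow_zero, one_mul, mul_one, Finset.prod_const_one] at this
    exact (norm_nonneg _).trans this
  have hδj := hδ j
  by_cases hp : |p - p'| ^ N = 0
  · rw [hp, zero_mul]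
    have := L2_nonneg v
    have := L2_nonneg u
    have := (multConst_pos n).le
    positivity
  have hp0 : 0 < |p - p'| ^ N := lt_of_le_of_ne (by positivity) (Ne.symm hp)
  set I : Set (Vec n) := Set.Icc c' d'
  set κ : Vec n × Vec n × Vec n → ℂ := fun z =>
    I.indicator 1 z.2.2 * (χ z.2.1 * phase z.2.1 z.1 z.2.2 * v z.1) with hκ
  have hκm : Measurable κ :=
    ((measurable_one.indicator measurableSet_Icc).comp
      (measurable_snd.comp measurable_snd)).mul
      (((hχ.continuous.measurable.comp (measurable_fst.comp measurable_snd)).mul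
        continuous_phase.measurable).mul (hv.measurable.comp measurable_fst))
  have hind : ∀ x, ‖I.indicator (1 : Vec n → ℂ) x‖ ≤ 1 := fun x => by
    refine (norm_indicator_le_norm_self _ _).trans ?_
    simp
  have hκb : ∀ z, ‖κ z‖ ≤ A * Cv := fun z => by
    rw [hκ, norm_mul, norm_mul, norm_mul, norm_phase, mul_one]
    calc _ ≤ 1 * (A * Cv) := by
          gcongr
          · exact hind _
          · exact hA1 _
          · exact (hv' _).1
      _ = _ := one_mul _
  have hκ0 : ∀ z ∉ Metric.closedBall (0 : Vec n) Rv ×ˢ (Metric.closedBall (0 : Vec n) R ×ˢ I),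
      κ z = 0 := by
    rintro ⟨x, ξ, y⟩ hz
    simp only [Set.mem_prod, mem_closedBall_zero_iff, not_and_or, not_le] at hz
    rcases hz with hz | hz | hz
    · simp [hκ, (hv' x).2 hz]
    · simp [hκ, hχ0 _ hz]
    · simp [hκ, hz]
  have hmain := norm_integral_mixPoint_le (μ := (volume : Measure (Vec n × Vec n × Vec n)))
    (X := fun z => z.2.2) (continuous_snd.comp continuous_snd) hκm hκb
    ((isCompact_closedBall _ _).prod ((isCompact_closedBall _ _).prod isCompact_Icc)) hκ0
    hcd' hδ hdc' (List.finRange n) (List.nodup_finRange n) (fun y z => F z.1 (h • z.2.1) y)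
    (hF.comp ((contDiff_fst.comp contDiff_snd).prodMk
      (((contDiff_fst.comp (contDiff_snd.comp contDiff_snd)).const_smul h).prodMk contDiff_fst)))
    u hu.measurable ⟨Cu, fun x => (hu' x).1⟩ hucd
    ((4 * δ j) ^ N * (2 ^ n * (multConst n * (A * K) * (L2 v * L2 u))) / |p - p'| ^ N) ?_
    c' le_rfl hcd'
  · have hmp : ∀ x, mixPoint (List.finRange n) c' x = x := fun x => by ext i; simp [mixPoint]
    simp only [hmp, List.length_finRange] at hmain
    rw [← mul_div_assoc, le_div_iff₀ hp0] at hmain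
    calc _ = _ := by
          rw [mul_comm]
          congr 2
          refine integral_congr_ae (Filter.Eventually.of_forall fun z => ?_)
          simp only [hκ]
          by_cases h0 : u z.2.2 = 0
          · simp [h0]
          · have : z.2.2 ∈ I := hucd _ h0
            simp only [Set.indicator, this, if_true, Pi.one_apply]; ring
      _ ≤ _ := hmain
      _ = _ := by
          rw [show (4 : ℝ) ^ n = 2 ^ n * 2 ^ n by rw [← mul_pow]; norm_num]; ring
  · intro A₃ hA₃ τ h1 h2 u₁ hu₁m hle
    set P : ℝ := ∏ i, δ i ^ A₃ i
    have hP : 0 < P := Finset.prod_pos fun i _ => pow_pos (hδ i) _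
    rw [← Fin.prod_univ_def]
    have hB : BddSupp (I.indicator u₁) :=
      (hu.of_le hu₁m (K := 1) (by simpa using hle)).indicator measurableSet_Icc
    have hle' : ∀ x, ‖I.indicator u₁ x‖ ≤ ‖u x‖ := fun x =>
      (norm_indicator_le_norm_self _ _).trans (hle x)
    have hne : ∀ x, I.indicator u₁ x ≠ 0 → u x ≠ 0 := fun x hx h0 => hx (by
      have := hle' x
      rwa [h0, norm_zero, norm_le_zero_iff] at this)
    have hL : L2 (I.indicator u₁) ≤ L2 u := by
      simpa using hu.L2_le (u := I.indicator u₁) (K := 1) zero_le_one (by simpa using hle')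
    have e : ∫ z : Vec n × Vec n × Vec n, mpdL (List.finRange n) A₃
        (fun y => F z.1 (h • z.2.1) y) τ * (u₁ z.2.2 * κ z) =
        ampForm h χ (fun x ξ => d3B A₃ F x ξ τ) v (I.indicator u₁) := by
      refine integral_congr_ae (Filter.Eventually.of_forall fun z => ?_)
      simp only [hκ, ← mpd_eq_mpdL, d3B]
      by_cases hz : z.2.2 ∈ I
      · simp only [Set.indicator, hz, if_true, Pi.one_apply]; ring
      · simp [Set.indicator, hz]
    rw [e]
    have key := pow_mul_norm_ampForm_le (R := R) hh hcd hδ hdc j p p' N A (K / P) (L2 v) (L2 u)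
      χ (fun x ξ => d3B A₃ F x ξ τ) v (I.indicator u₁) hχ hχ0 hA
      ((contDiff_d3B hF A₃).comp (contDiff_fst.prodMk (contDiff_snd.prodMk contDiff_const)))
      (fun i hi A' hA' x hx1 hx2 ξ => by
        have := hK i hi A' hA' A₃ hA₃ x hx1 hx2 τ h1 h2 ξ
        simp only [d1B, d2B, mpd_single] at this
        rw [div_mul_eq_mul_div, le_div_iff₀ hP]
        refine le_trans (le_of_eq ?_) this
        ring)
      hv hvcd hvp le_rfl hB (fun x hx => hup x (hne x hx)) hL
    rw [le_div_iff₀ hp0]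
    calc _ = |p - p'| ^ N * ‖ampForm h χ (fun x ξ => d3B A₃ F x ξ τ) v (I.indicator u₁)‖ * P := by
          ring
      _ ≤ _ := mul_le_mul_of_nonneg_right key hP.le
      _ = _ := by field_simp

end Decay

section Lattice

variable {n : ℕ}

/-- The index of the cell of the lattice `∏ δ i ℤ` containing `x`. -/
noncomputable def cellIndex (δ : Vec n) (x : Vec n) : Fin n → ℤ := fun i => ⌊x i / δ i⌋

/-- The restriction of `v` to the cell with index `k`. -/
noncomputable def cellPart (δ : Vec n) (v : Vec n → ℂ) (k : Fin n → ℤ) : Vec n → ℂ :=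
  fun x => if cellIndex δ x = k then v x else 0

lemma measurable_cellIndex (δ : Vec n) : Measurable (cellIndex δ) :=
  measurable_pi_lambda _ fun i => Int.measurable_floor.comp ((measurable_pi_apply i).div_const _)

lemma norm_cellPart_le (δ : Vec n) (v : Vec n → ℂ) (k : Fin n → ℤ) (x : Vec n) :
    ‖cellPart δ v k x‖ ≤ ‖v x‖ := by
  unfold cellPart; split_ifs <;> simp

lemma BddSupp.cellPart {v : Vec n → ℂ} (hv : BddSupp v) (δ : Vec n) (k : Fin n → ℤ) :
    BddSupp (cellPart δ v k) :=
  hv.of_le (Measurable.ite (measurable_cellIndex δ (measurableSet_singleton k)) hv.measurable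
    measurable_const) (K := 1) fun x => by rw [one_mul]; exact norm_cellPart_le δ v k x

lemma cellPart_ne_zero {δ : Vec n} (hδ : ∀ i, 0 < δ i) {v : Vec n → ℂ} {k : Fin n → ℤ} {x : Vec n}
    (h : cellPart δ v k x ≠ 0) :
    v x ≠ 0 ∧ ∀ i, δ i * k i ≤ x i ∧ x i ≤ δ i * (k i + 1) := by
  unfold cellPart at h
  split_ifs at h with hk
  · refine ⟨h, fun i => ?_⟩
    have hi : ⌊x i / δ i⌋ = k i := congrFun hk i
    have h1 := Int.floor_le (x i / δ i)
    have h2 := (Int.lt_floor_add_one (x i / δ i)).le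
    rw [hi] at h1 h2
    rw [le_div_iff₀ (hδ i)] at h1
    rw [div_le_iff₀ (hδ i)] at h2
    constructor <;> linarith
  · exact absurd rfl h

lemma sum_cellPart {δ : Vec n} {v : Vec n → ℂ} {S : Finset (Fin n → ℤ)}
    (hS : ∀ x, v x ≠ 0 → cellIndex δ x ∈ S) (x : Vec n) : ∑ k ∈ S, cellPart δ v k x = v x := by
  by_cases hx : v x = 0
  · simp [cellPart, hx]
  · simp [cellPart, hS x hx]

lemma sum_L2_cellPart_sq_le {δ : Vec n} {v : Vec n → ℂ} (hv : BddSupp v)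
    (S : Finset (Fin n → ℤ)) : ∑ k ∈ S, L2 (cellPart δ v k) ^ 2 ≤ L2 v ^ 2 := by
  simp_rw [L2_sq]
  rw [← integral_finsetSum _ fun k _ => (hv.cellPart δ k).integrable_sq]
  refine integral_mono (integrable_finsetSum _ fun k _ => (hv.cellPart δ k).integrable_sq)
    hv.integrable_sq fun x => ?_
  have : ∀ k, ‖cellPart δ v k x‖ ^ 2 = if cellIndex δ x = k then ‖v x‖ ^ 2 else 0 := fun k => by
    unfold cellPart; split_ifs <;> simp
  simp only [this, Finset.sum_ite_eq]
  split_ifs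
  exacts [le_rfl, sq_nonneg _]

/-- The weight `(1 + |m|)⁻²` on the integers. -/
noncomputable def intWeight (m : ℤ) : ℝ := ((1 + |(m : ℝ)|) ^ 2)⁻¹

lemma intWeight_pos (m : ℤ) : 0 < intWeight m := by unfold intWeight; positivity

lemma summable_intWeight : Summable intWeight := by
  have h : Summable fun k : ℕ => ((1 + (k : ℝ)) ^ 2)⁻¹ := by
    have := (summable_nat_add_iff 1).2 (Real.summable_nat_pow_inv.2 one_lt_two)
    refine this.congr fun k => ?_
    push_cast; rw [add_comm]
  refine Summable.of_nat_of_neg (h.congr fun k => ?_) (h.congr fun k => ?_) <;> simp [intWeight]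

/-- The total mass of `intWeight`. -/
noncomputable def intMass : ℝ := ∑' m, intWeight m

lemma intMass_pos : 0 < intMass := summable_intWeight.tsum_pos (fun m => (intWeight_pos m).le) 0
  (intWeight_pos 0)

lemma sum_intWeight_sub_le (S : Finset ℤ) (k : ℤ) : ∑ l ∈ S, intWeight (k - l) ≤ intMass := by
  have h : Function.Injective fun l : ℤ => k - l := fun a b hab => by simpa using hab
  refine (Finset.sum_map S ⟨_, h⟩ intWeight).symm.trans_le ?_
  exact summable_intWeight.sum_le_tsum _ fun m _ => (intWeight_pos m).le

lemma intWeight_sub_comm (k l : ℤ) : intWeight (k - l) = intWeight (l - k) := by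
  simp only [intWeight]
  push_cast
  rw [abs_sub_comm]

lemma sum_prod_intWeight_le (T : Fin n → Finset ℤ) (k : Fin n → ℤ) :
    ∑ l ∈ Fintype.piFinset T, ∏ i, intWeight (k i - l i) ≤ intMass ^ n := by
  rw [← Finset.prod_univ_sum T fun i m => intWeight (k i - m)]
  calc _ ≤ ∏ _i : Fin n, intMass := Finset.prod_le_prod
        (fun i _ => Finset.sum_nonneg fun m _ => (intWeight_pos _).le)
        fun i _ => sum_intWeight_sub_le _ _
    _ = _ := by simp

/-- Schur's test for finite sums. -/
lemma sum_sum_mul_le_of_schur {ι : Type*} {S : Finset ι} {W : ι → ι → ℝ} (hW : ∀ k l, 0 ≤ W k l)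
    {Z : ℝ} (h1 : ∀ k, ∑ l ∈ S, W k l ≤ Z) (h2 : ∀ l, ∑ k ∈ S, W k l ≤ Z) (hZ : 0 ≤ Z)
    (a b : ι → ℝ) :
    ∑ k ∈ S, ∑ l ∈ S, W k l * (a k * b l) ≤
      Z * (Real.sqrt (∑ k ∈ S, a k ^ 2) * Real.sqrt (∑ l ∈ S, b l ^ 2)) := by
  have h := Real.sum_mul_le_sqrt_mul_sqrt (S ×ˢ S) (fun p => Real.sqrt (W p.1 p.2) * a p.1)
    (fun p => Real.sqrt (W p.1 p.2) * b p.2)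
  simp_rw [mul_pow, Real.sq_sqrt (hW _ _)] at h
  rw [Finset.sum_product, Finset.sum_product, Finset.sum_product_right] at h
  calc _ = ∑ k ∈ S, ∑ l ∈ S, Real.sqrt (W k l) * a k * (Real.sqrt (W k l) * b l) := by
        refine Finset.sum_congr rfl fun k _ => Finset.sum_congr rfl fun l _ => ?_
        linear_combination (-(a k * b l)) * Real.mul_self_sqrt (hW k l)
    _ ≤ _ := h
    _ ≤ Real.sqrt (Z * ∑ k ∈ S, a k ^ 2) * Real.sqrt (Z * ∑ l ∈ S, b l ^ 2) := by
        gcongr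
        · simp_rw [← Finset.sum_mul]
          rw [Finset.mul_sum]
          exact Finset.sum_le_sum fun k _ => mul_le_mul_of_nonneg_right (h1 k) (sq_nonneg _)
        · simp_rw [← Finset.sum_mul]
          rw [Finset.mul_sum]
          exact Finset.sum_le_sum fun k _ => mul_le_mul_of_nonneg_right (h2 k) (sq_nonneg _)
    _ = _ := by
        rw [Real.sqrt_mul hZ, Real.sqrt_mul hZ]
        linear_combination (Real.sqrt (∑ k ∈ S, a k ^ 2) * Real.sqrt (∑ l ∈ S, b l ^ 2)) *
          Real.mul_self_sqrt hZ

lemma mul_prod_sq_le {B X : ℝ} (hB : 0 ≤ B) (hX : 0 ≤ X) [NeZero n] (L : Fin n → ℝ)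
    (h0 : B ≤ X) (h : ∀ j, |L j| ^ (2 * n) * B ≤ 4 ^ (2 * n) * X) :
    B ≤ 4 ^ n * (1 + 4 ^ (2 * n)) * X * ∏ i, ((1 + |L i|) ^ 2)⁻¹ := by
  obtain ⟨j, -, hj⟩ := Finset.exists_max_image Finset.univ (fun i => |L i|)
    ⟨(0 : Fin n), Finset.mem_univ _⟩
  have hP : 0 < ∏ i, (1 + |L i|) ^ 2 := Finset.prod_pos fun i _ => by positivity
  rw [Finset.prod_inv_distrib, ← div_eq_mul_inv, le_div_iff₀ hP]
  set m := |L j| with hm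
  have hm0 : 0 ≤ m := abs_nonneg _
  have h1 : ∏ i, (1 + |L i|) ^ 2 ≤ (1 + m) ^ (2 * n) := by
    calc _ ≤ ∏ _i : Fin n, (1 + m) ^ 2 := Finset.prod_le_prod (fun i _ => by positivity)
          fun i _ => by
            have := hj i (Finset.mem_univ _)
            gcongr
      _ = _ := by simp [pow_mul]
  have h2 : (1 + m) ^ (2 * n) ≤ 4 ^ n * (1 + m ^ (2 * n)) := by
    rw [show (4 : ℝ) ^ n = 2 ^ (2 * n) by rw [pow_mul]; norm_num]
    rcases le_total m 1 with hm1 | hm1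
    · calc (1 + m) ^ (2 * n) ≤ 2 ^ (2 * n) := by gcongr; linarith
        _ ≤ _ := le_mul_of_one_le_right (by positivity) (by
          have : 0 ≤ m ^ (2 * n) := by positivity
          linarith)
    · calc (1 + m) ^ (2 * n) ≤ (2 * m) ^ (2 * n) := by gcongr; linarith
        _ = 2 ^ (2 * n) * m ^ (2 * n) := mul_pow _ _ _
        _ ≤ _ := by gcongr; linarith
  calc _ ≤ B * (4 ^ n * (1 + m ^ (2 * n))) := by gcongr; exact h1.trans h2
    _ = 4 ^ n * (B + m ^ (2 * n) * B) := by ring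
    _ ≤ 4 ^ n * (X + 4 ^ (2 * n) * X) := by
        have := h j
        gcongr
    _ = _ := by ring

lemma norm_biForm_cellPart_le [NeZero n] {h R : ℝ} (hh : 0 < h) {δ : Vec n} (hδ : ∀ i, 0 < δ i)
    {r r' A K : ℝ} {χ : Vec n → ℂ}
    {F : Vec n → Vec n → Vec n → ℂ} {v u : Vec n → ℂ} (hχ : ContDiff ℝ (⊤ : ℕ∞) χ)
    (hχ0 : ∀ ξ, R < ‖ξ‖ → χ ξ = 0)
    (hA : ∀ i ≤ 2 * n, ∀ j ξ, ‖(pdC j)^[i] χ ξ‖ ≤ A * δ j ^ i)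
    (hF : ContDiff ℝ (⊤ : ℕ∞) fun z : Vec n × Vec n × Vec n => F z.1 z.2.1 z.2.2)
    (hK : ∀ j, ∀ i ≤ 2 * n, ∀ A₁ : Fin n → ℕ, (∀ i, A₁ i ≤ 1) → ∀ A₃ : Fin n → ℕ,
      (∀ i, A₃ i ≤ 1) → ∀ x y ξ, |x 0 - r| ≤ 1 → |y 0 - r'| ≤ 1 →
      h ^ i * ‖d1B A₁ (d2B (Pi.single j i) (d3B A₃ F)) x ξ y‖ *
        ((∏ i, δ i ^ A₁ i) * ∏ i, δ i ^ A₃ i) ≤ K * δ j ^ i)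
    (hv : BddSupp v) (hvr : ∀ x, v x ≠ 0 → |x 0 - r| ≤ 1)
    (hu : BddSupp u) (hur : ∀ x, u x ≠ 0 → |x 0 - r'| ≤ 1) (k l : Fin n → ℤ) :
    ‖biForm h χ F (cellPart δ v k) (cellPart δ u l)‖ ≤
      4 ^ n * (1 + 4 ^ (2 * n)) * (4 ^ n * (multConst n * (A * K) *
        (L2 (cellPart δ v k) * L2 (cellPart δ u l)))) * ∏ i, intWeight (k i - l i) := by
  have hA0 : 0 ≤ A := by simpa using (norm_nonneg _).trans (hA 0 (Nat.zero_le _) 0 0)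
  have hK0 : 0 ≤ K := by
    have := hK 0 0 (Nat.zero_le _) (fun _ => 0) (fun _ => zero_le_one) (fun _ => 0)
      (fun _ => zero_le_one) (fun _ => r) (fun _ => r') 0 (by simp) (by simp)
    simp only [pow_zero, one_mul, mul_one, Finset.prod_const_one] at this
    exact (norm_nonneg _).trans this
  have hX0 : 0 ≤ 4 ^ n * (multConst n * (A * K) *
      (L2 (cellPart δ v k) * L2 (cellPart δ u l))) := by
    have := L2_nonneg (cellPart δ v k)
    have := L2_nonneg (cellPart δ u l)
    have := (multConst_pos n).le
    positivity
  -- the box attached to a cell, cut by the strip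
  set lo : ℝ → (Fin n → ℤ) → Vec n := fun s k i =>
    if i = 0 then max (δ i * k i) (s - 1) else δ i * k i with hlo
  set hi : ℝ → (Fin n → ℤ) → Vec n := fun s k i =>
    if i = 0 then min (δ i * (k i + 1)) (s + 1) else δ i * (k i + 1) with hhi
  have hbox : ∀ (w : Vec n → ℂ) (s : ℝ) (m : Fin n → ℤ), (∀ x, w x ≠ 0 → |x 0 - s| ≤ 1) → ∀ x,
      cellPart δ w m x ≠ 0 → lo s m ≤ x ∧ x ≤ hi s m := by
    intro w s m hw x hx
    obtain ⟨h1, h2⟩ := cellPart_ne_zero hδ hx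
    have h3 := abs_le.1 (hw x h1)
    constructor <;> intro i <;> simp only [hlo, hhi] <;> split_ifs with h0
    · subst h0; exact max_le (h2 0).1 (by linarith)
    · exact (h2 i).1
    · subst h0; exact le_min (h2 0).2 (by linarith)
    · exact (h2 i).2
  have hwidth : ∀ (s : ℝ) (m : Fin n → ℤ) i, hi s m i - lo s m i ≤ δ i := by
    intro s m i
    have h1 : hi s m i ≤ δ i * (m i + 1) := by
      simp only [hhi]; split_ifs <;> simp
    have h2 : δ i * m i ≤ lo s m i := by
      simp only [hlo]; split_ifs <;> simp
    linarith
  have hstrip : ∀ (s : ℝ) (m : Fin n → ℤ) (x : Vec n), lo s m ≤ x → x ≤ hi s m → |x 0 - s| ≤ 1 := by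
    intro s m x h1 h2
    have h3 := (h1 0)
    have h4 := (h2 0)
    simp only [hlo, hhi, if_true] at h3 h4
    have := (le_max_right _ _).trans h3
    have := h4.trans (min_le_right _ _)
    rw [abs_le]; constructor <;> linarith
  have hpos : ∀ (w : Vec n → ℂ) (m : Fin n → ℤ) (j : Fin n) x, cellPart δ w m x ≠ 0 →
      |x j - δ j * m j| ≤ δ j := by
    intro w m j x hx
    have := (cellPart_ne_zero hδ hx).2 j
    have := hδ j
    rw [abs_le]; constructor <;> linarith
  by_cases hv0 : ∀ x, cellPart δ v k x = 0
  · have : biForm h χ F (cellPart δ v k) (cellPart δ u l) = 0 := by simp [biForm, hv0]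
    rw [this, norm_zero]
    have := Finset.prod_nonneg fun i (_ : i ∈ Finset.univ) => (intWeight_pos (k i - l i)).le
    positivity
  by_cases hu0 : ∀ x, cellPart δ u l x = 0
  · have : biForm h χ F (cellPart δ v k) (cellPart δ u l) = 0 := by simp [biForm, hu0]
    rw [this, norm_zero]
    have := Finset.prod_nonneg fun i (_ : i ∈ Finset.univ) => (intWeight_pos (k i - l i)).le
    positivity
  push Not at hv0 hu0
  obtain ⟨x₀, hx₀⟩ := hv0
  obtain ⟨y₀, hy₀⟩ := hu0
  have hb1 := hbox v r k hvr
  have hb2 := hbox u r' l hur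
  have key := fun (j : Fin n) (N : ℕ) (hN : N ≤ 2 * n) => pow_mul_norm_biForm_le (R := R) hh
    ((hb1 x₀ hx₀).1.trans (hb1 x₀ hx₀).2) ((hb2 y₀ hy₀).1.trans (hb2 y₀ hy₀).2) hδ
    (hwidth r k) (hwidth r' l) j (δ j * k j) (δ j * l j) N (K := K) hχ hχ0
    (fun i hi => hA i (hi.trans hN) j) hF
    (fun i hi A₁ h1 A₃ h3 x hx1 hx2 y hy1 hy2 ξ => hK j i (hi.trans hN) A₁ h1 A₃ h3 x y ξ
      (hstrip r k x hx1 hx2) (hstrip r' l y hy1 hy2))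
    (hv.cellPart δ k) hb1 (hpos v k j) (hu.cellPart δ l) hb2 (hpos u l j)
  have := mul_prod_sq_le (norm_nonneg (biForm h χ F (cellPart δ v k) (cellPart δ u l))) hX0
    (fun i => (k i : ℝ) - l i) (by simpa using key 0 0 (Nat.zero_le _)) (fun j => by
      have := key j (2 * n) le_rfl
      have hd := hδ j
      rw [← mul_sub, abs_mul, abs_of_pos hd, mul_pow, mul_pow] at this
      have hd' : 0 < δ j ^ (2 * n) := by positivity
      refine le_of_mul_le_mul_left ?_ hd'
      calc _ = _ := by ring
        _ ≤ _ := this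
        _ = _ := by ring)
  simpa only [intWeight, Int.cast_sub] using this

lemma biForm_eq_sum_cellPart {h R : ℝ} {δ : Vec n} {χ : Vec n → ℂ}
    {F : Vec n → Vec n → Vec n → ℂ} {v u : Vec n → ℂ} (hχ : Continuous χ)
    (hχ0 : ∀ ξ, R < ‖ξ‖ → χ ξ = 0)
    (hF : Continuous fun z : Vec n × Vec n × Vec n => F z.1 z.2.1 z.2.2)
    (hv : BddSupp v) (hu : BddSupp u) {S : Finset (Fin n → ℤ)}
    (hSv : ∀ x, v x ≠ 0 → cellIndex δ x ∈ S) (hSu : ∀ x, u x ≠ 0 → cellIndex δ x ∈ S) :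
    biForm h χ F v u = ∑ k ∈ S, ∑ l ∈ S, biForm h χ F (cellPart δ v k) (cellPart δ u l) := by
  have hi := fun k l => integrable_biForm (h := h) hχ hχ0 hF (hv.cellPart δ k) (hu.cellPart δ l)
  simp only [biForm]
  calc _ = ∫ z : Vec n × Vec n × Vec n, ∑ k ∈ S, ∑ l ∈ S, χ z.2.1 * F z.1 (h • z.2.1) z.2.2 *
        phase z.2.1 z.1 z.2.2 * cellPart δ v k z.1 * cellPart δ u l z.2.2 := by
        refine integral_congr_ae (Filter.Eventually.of_forall fun z => ?_)
        simp only
        rw [← sum_cellPart hSv z.1, ← sum_cellPart hSu z.2.2]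
        simp_rw [Finset.mul_sum, Finset.sum_mul]
        exact Finset.sum_comm
    _ = _ := by
        rw [integral_finsetSum _ fun k _ => integrable_finsetSum _ fun l _ => hi k l]
        exact Finset.sum_congr rfl fun k _ => integral_finsetSum _ fun l _ => hi k l

/-- The constant in the `L²` bound for `biForm`. -/
noncomputable def cvConst (n : ℕ) : ℝ :=
  4 ^ n * (1 + 4 ^ (2 * n)) * 4 ^ n * multConst n * intMass ^ n

lemma cvConst_pos (n : ℕ) : 0 < cvConst n := by
  have := multConst_pos n
  have := intMass_pos
  unfold cvConst
  positivity

/-- A Calderón–Vaillancourt type bound for functions supported in strips. -/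
lemma norm_biForm_le [NeZero n] {h R : ℝ} (hh : 0 < h) {δ : Vec n} (hδ : ∀ i, 0 < δ i)
    {r r' A K : ℝ} {χ : Vec n → ℂ}
    {F : Vec n → Vec n → Vec n → ℂ} {v u : Vec n → ℂ} (hχ : ContDiff ℝ (⊤ : ℕ∞) χ)
    (hχ0 : ∀ ξ, R < ‖ξ‖ → χ ξ = 0)
    (hA : ∀ i ≤ 2 * n, ∀ j ξ, ‖(pdC j)^[i] χ ξ‖ ≤ A * δ j ^ i)
    (hF : ContDiff ℝ (⊤ : ℕ∞) fun z : Vec n × Vec n × Vec n => F z.1 z.2.1 z.2.2)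
    (hK : ∀ j, ∀ i ≤ 2 * n, ∀ A₁ : Fin n → ℕ, (∀ i, A₁ i ≤ 1) → ∀ A₃ : Fin n → ℕ,
      (∀ i, A₃ i ≤ 1) → ∀ x y ξ, |x 0 - r| ≤ 1 → |y 0 - r'| ≤ 1 →
      h ^ i * ‖d1B A₁ (d2B (Pi.single j i) (d3B A₃ F)) x ξ y‖ *
        ((∏ i, δ i ^ A₁ i) * ∏ i, δ i ^ A₃ i) ≤ K * δ j ^ i)
    (hv : BddSupp v) (hvr : ∀ x, v x ≠ 0 → |x 0 - r| ≤ 1)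
    (hu : BddSupp u) (hur : ∀ x, u x ≠ 0 → |x 0 - r'| ≤ 1) :
    ‖biForm h χ F v u‖ ≤ cvConst n * (A * K) * (L2 v * L2 u) := by
  have hA0 : 0 ≤ A := by simpa using (norm_nonneg _).trans (hA 0 (Nat.zero_le _) 0 0)
  have hK0 : 0 ≤ K := by
    have := hK 0 0 (Nat.zero_le _) (fun _ => 0) (fun _ => zero_le_one) (fun _ => 0)
      (fun _ => zero_le_one) (fun _ => r) (fun _ => r') 0 (by simp) (by simp)
    simp only [pow_zero, one_mul, mul_one, Finset.prod_const_one] at this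
    exact (norm_nonneg _).trans this
  obtain ⟨_, Rv, hv'⟩ := hv.exists_bound
  obtain ⟨_, Ru, hu'⟩ := hu.exists_bound
  set ρ := max Rv Ru
  set T : Fin n → Finset ℤ := fun i => Finset.Icc ⌊-ρ / δ i⌋ ⌊ρ / δ i⌋
  have hS : ∀ x : Vec n, ‖x‖ ≤ ρ → cellIndex δ x ∈ Fintype.piFinset T := by
    intro x hx
    refine Fintype.mem_piFinset.2 fun i => ?_
    have := abs_le.1 ((norm_le_pi_norm x i).trans hx)
    have hd := hδ i
    refine Finset.mem_Icc.2 ⟨Int.floor_le_floor ?_, Int.floor_le_floor ?_⟩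
    · gcongr; exact this.1
    · gcongr; exact this.2
  have hm := multConst_pos n
  set Q : ℝ := 4 ^ n * (1 + 4 ^ (2 * n)) * 4 ^ n * multConst n * (A * K) with hQ
  rw [biForm_eq_sum_cellPart (δ := δ) hχ.continuous hχ0 hF.continuous hv hu
    (S := Fintype.piFinset T)
    (fun x hx => hS x (by by_contra hc; exact hx ((hv' x).2 ((le_max_left _ _).trans_lt (not_le.1 hc)))))
    (fun x hx => hS x (by by_contra hc; exact hx ((hu' x).2 ((le_max_right _ _).trans_lt (not_le.1 hc)))))]
  calc _ ≤ ∑ k ∈ Fintype.piFinset T, ∑ l ∈ Fintype.piFinset T,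
        Q * ((∏ i, intWeight (k i - l i)) * (L2 (cellPart δ v k) * L2 (cellPart δ u l))) := by
        refine (norm_sum_le _ _).trans (Finset.sum_le_sum fun k _ =>
          (norm_sum_le _ _).trans (Finset.sum_le_sum fun l _ => ?_))
        refine (norm_biForm_cellPart_le hh hδ hχ hχ0 hA hF hK hv hvr hu hur k l).trans_eq ?_
        rw [hQ]; ring
    _ = Q * ∑ k ∈ Fintype.piFinset T, ∑ l ∈ Fintype.piFinset T,
        (∏ i, intWeight (k i - l i)) * (L2 (cellPart δ v k) * L2 (cellPart δ u l)) := by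
        simp_rw [Finset.mul_sum]
    _ ≤ Q * (intMass ^ n * (L2 v * L2 u)) := by
        refine mul_le_mul_of_nonneg_left ?_ (by positivity)
        refine (sum_sum_mul_le_of_schur (S := Fintype.piFinset T)
          (W := fun k l => ∏ i, intWeight (k i - l i))
          (fun k l => Finset.prod_nonneg fun i _ => (intWeight_pos _).le)
          (sum_prod_intWeight_le T) (fun l => ?_) (pow_pos intMass_pos n).le _ _).trans ?_
        · simp_rw [fun k : Fin n → ℤ => Finset.prod_congr rfl fun i (_ : i ∈ Finset.univ) =>
            intWeight_sub_comm (k i) (l i)]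
          exact sum_prod_intWeight_le T l
        · refine mul_le_mul_of_nonneg_left ?_ (pow_pos intMass_pos n).le
          refine mul_le_mul ?_ ?_ (Real.sqrt_nonneg _) (L2_nonneg _)
          · exact Real.sqrt_le_iff.2 ⟨L2_nonneg _, sum_L2_cellPart_sq_le hv _⟩
          · exact Real.sqrt_le_iff.2 ⟨L2_nonneg _, sum_L2_cellPart_sq_le hu _⟩
    _ = _ := by rw [hQ, cvConst]; ring

end Lattice

section SymbolBounds

variable {n : ℕ}

lemma le_iSup_three {α β γ : Type*} {f : α → β → γ → ℝ} {C : ℝ} (hC : 0 ≤ C)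
    (hf : ∀ a b c, f a b c ≤ C) (a : α) (b : β) (c : γ) :
    f a b c ≤ ⨆ a, ⨆ b, ⨆ c, f a b c :=
  le_ciSup_of_le ⟨C, Set.forall_mem_range.2 fun a => Real.iSup_le (fun b =>
      Real.iSup_le (fun c => hf a b c) hC) hC⟩ a <|
    le_ciSup_of_le ⟨C, Set.forall_mem_range.2 fun b => Real.iSup_le (fun c => hf a b c) hC⟩ b <|
      le_ciSup ⟨C, Set.forall_mem_range.2 fun c => hf a b c⟩ c

lemma iSup_three_le {α β γ : Type*} {f : α → β → γ → ℝ} {C : ℝ} (hC : 0 ≤ C)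
    (hf : ∀ a b c, f a b c ≤ C) : ⨆ a, ⨆ b, ⨆ c, f a b c ≤ C :=
  Real.iSup_le (fun a => Real.iSup_le (fun b => Real.iSup_le (fun c => hf a b c) hC) hC) hC

lemma lamT_pos {lam : ℝ → ℝ} (hlam : Admissible lam) (t : ℝ) (j k : ℤ) : 0 < lamT lam t j k :=
  hlam.1 _

lemma jbr_pos [NeZero n] (μ : ℝ) (p : Vec n) : 0 < jbr μ p := by
  have := Finset.sum_nonneg fun i (_ : i ∈ Finset.univ) =>
    sq_nonneg (if i = (0 : Fin n) then p i else μ⁻¹ * p i)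
  exact Real.sqrt_pos.2 (by linarith)

lemma bisymSeminorm_term_nonneg [NeZero n] {lam : ℝ → ℝ} (hlam : Admissible lam)
    (M : ℕ) (t : ℝ) (a : Vec n → Vec n → Vec n → ℂ) (A B A' : Fin n → ℕ) :
    0 ≤ if fullLen A + fullLen B + fullLen A' ≤ M then
      ⨆ j : ℤ, ⨆ k : ℤ, ⨆ q : Vec n, ⨆ p : Vec n, ⨆ q' : Vec n,
        if |q 0 - (j : ℝ)| ≤ 1 ∧ |q' 0 - (k : ℝ)| ≤ 1 then
          jbr (lamT lam t j k) p ^ (-0 + 0 * (fullLen B : ℝ)) *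
            (lamT lam t j k ^ ((angLen B : ℤ) - (angLen A : ℤ) - (angLen A' : ℤ)) *
              ‖d1B A (d2B B (d3B A' a)) q p q'‖)
        else 0
    else 0 := by
  split_ifs
  · refine Real.iSup_nonneg fun j => Real.iSup_nonneg fun k => Real.iSup_nonneg fun q =>
      Real.iSup_nonneg fun p => Real.iSup_nonneg fun q' => ?_
    have := jbr_pos (lamT lam t j k) p
    have := lamT_pos hlam t j k
    split_ifs <;> positivity
  · exact le_rfl

lemma bisymSeminorm_nonneg [NeZero n] {lam : ℝ → ℝ} (hlam : Admissible lam) (M : ℕ) (t : ℝ)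
    (a : Vec n → Vec n → Vec n → ℂ) : 0 ≤ bisymSeminorm lam M 0 0 t a :=
  Finset.sum_nonneg fun _ _ => Finset.sum_nonneg fun _ _ => Finset.sum_nonneg fun _ _ =>
    bisymSeminorm_term_nonneg hlam M t a _ _ _

lemma le_fullLen (A : Fin n → ℕ) (i : Fin n) : A i ≤ fullLen A :=
  Finset.single_le_sum (f := A) (fun _ _ => Nat.zero_le _) (Finset.mem_univ i)

lemma IsBisymbol.le_bisymSeminorm [NeZero n] {lam : ℝ → ℝ} (hlam : Admissible lam) {t : ℝ}
    {a : Vec n → Vec n → Vec n → ℂ} (ha : IsBisymbol lam 0 0 t a) {M : ℕ} {A B A' : Fin n → ℕ}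
    (hM : fullLen A + fullLen B + fullLen A' ≤ M) {j k : ℤ} {q p q' : Vec n}
    (hq : |q 0 - (j : ℝ)| ≤ 1) (hq' : |q' 0 - (k : ℝ)| ≤ 1) :
    lamT lam t j k ^ ((angLen B : ℤ) - (angLen A : ℤ) - (angLen A' : ℤ)) *
      ‖d1B A (d2B B (d3B A' a)) q p q'‖ ≤ bisymSeminorm lam M 0 0 t a := by
  obtain ⟨C, hC, hb⟩ := ha.2 A B A'
  set f : ℤ → ℤ → Vec n → Vec n → Vec n → ℝ := fun j k q p q' =>
    if |q 0 - (j : ℝ)| ≤ 1 ∧ |q' 0 - (k : ℝ)| ≤ 1 then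
      jbr (lamT lam t j k) p ^ (-0 + 0 * (fullLen B : ℝ)) *
        (lamT lam t j k ^ ((angLen B : ℤ) - (angLen A : ℤ) - (angLen A' : ℤ)) *
          ‖d1B A (d2B B (d3B A' a)) q p q'‖)
    else 0 with hf
  have hfC : ∀ j k q p q', f j k q p q' ≤ C := by
    intro j k q p q'
    simp only [hf]
    split_ifs with h
    · simpa using hb j k q p q' h.1 h.2
    · exact hC.le
  have h0 : lamT lam t j k ^ ((angLen B : ℤ) - (angLen A : ℤ) - (angLen A' : ℤ)) *
      ‖d1B A (d2B B (d3B A' a)) q p q'‖ = f j k q p q' := by simp [hf, hq, hq']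
  have h1 : f j k q p q' ≤ ⨆ j, ⨆ k, ⨆ q, ⨆ p, ⨆ q', f j k q p q' := by
    refine le_ciSup_of_le ⟨C, Set.forall_mem_range.2 fun j => Real.iSup_le (fun k =>
      iSup_three_le hC.le (hfC j k)) hC.le⟩ j ?_
    refine le_ciSup_of_le ⟨C, Set.forall_mem_range.2 fun k =>
      iSup_three_le hC.le (hfC j k)⟩ k ?_
    exact le_iSup_three hC.le (hfC j k) q p q'
  rw [h0]
  refine h1.trans ?_
  have hlt : ∀ D : Fin n → ℕ, fullLen D ≤ M → ∀ i, D i < M + 1 := fun D hD i =>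
    Nat.lt_succ_of_le ((le_fullLen D i).trans hD)
  have hn := bisymSeminorm_term_nonneg hlam M t a
  refine le_trans (le_of_eq ?_) ((Finset.single_le_sum
      (fun A' _ => hn (fun i => (⟨A i, hlt A (by lia) i⟩ : Fin (M + 1)))
        (fun i => (⟨B i, hlt B (by lia) i⟩ : Fin (M + 1))) (fun i => A' i))
      (Finset.mem_univ (fun i => (⟨A' i, hlt A' (by lia) i⟩ : Fin (M + 1))))).trans
    ((Finset.single_le_sum (fun B _ => Finset.sum_nonneg fun A' _ =>
        hn (fun i => (⟨A i, hlt A (by lia) i⟩ : Fin (M + 1))) (fun i => B i) (fun i => A' i))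
      (Finset.mem_univ (fun i => (⟨B i, hlt B (by lia) i⟩ : Fin (M + 1))))).trans
    (Finset.single_le_sum (fun A _ => Finset.sum_nonneg fun B _ => Finset.sum_nonneg fun A' _ =>
        hn (fun i => A i) (fun i => B i) (fun i => A' i))
      (Finset.mem_univ (fun i => (⟨A i, hlt A (by lia) i⟩ : Fin (M + 1)))))))
  simp only [if_pos hM, hf]

lemma mpd_fun_zero (f : Vec n → ℂ) : mpd 0 f = f := mpd_zero f

lemma IsBisymbol.norm_le_biSup [NeZero n] {lam : ℝ → ℝ} {t : ℝ}
    {a : Vec n → Vec n → Vec n → ℂ} (ha : IsBisymbol lam 0 0 t a) (q p q' : Vec n) :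
    ‖a q p q'‖ ≤ biSup a := by
  obtain ⟨C, hC, hb⟩ := ha.2 0 0 0
  refine le_iSup_three (f := fun q p q' => ‖a q p q'‖) hC.le (fun q p q' => ?_) q p q'
  have hfl : ∀ x : ℝ, |x - ((⌊x⌋ : ℤ) : ℝ)| ≤ 1 := fun x => by
    rw [abs_of_nonneg (sub_nonneg.2 (Int.floor_le x))]
    linarith [Int.lt_floor_add_one x]
  have := hb ⌊q 0⌋ ⌊q' 0⌋ q p q' (hfl _) (hfl _)
  simpa [d1B, d2B, d3B, mpd_fun_zero, angLen, fullLen] using this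

/-- The semiclassical length scales dual to the weight `μ`. -/
noncomputable def scale [NeZero n] (h μ : ℝ) : Vec n :=
  fun i => if i = 0 then √h else √h * μ⁻¹

lemma scale_pos [NeZero n] {h μ : ℝ} (hh : 0 < h) (hμ : 0 < μ) (i : Fin n) :
    0 < scale h μ i := by
  unfold scale
  split_ifs <;> positivity

lemma prod_scale_pow [NeZero n] (h μ : ℝ) (A : Fin n → ℕ) :
    ∏ i, scale h μ i ^ A i = √h ^ fullLen A * (μ ^ angLen A)⁻¹ := by
  rw [fullLen, angLen, ← Finset.prod_pow_eq_pow_sum, ← Finset.prod_pow_eq_pow_sum,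
    ← Finset.prod_inv_distrib, ← Finset.prod_mul_distrib]
  refine Finset.prod_congr rfl fun i _ => ?_
  unfold scale
  split_ifs <;> simp [mul_pow]

lemma scale_pow [NeZero n] (h μ : ℝ) (j : Fin n) (i : ℕ) :
    scale h μ j ^ i = √h ^ i * (μ ^ angLen (Pi.single j i : Fin n → ℕ))⁻¹ := by
  have := prod_scale_pow h μ (Pi.single j i : Fin n → ℕ)
  rw [Finset.prod_eq_single j (fun b _ hb => by simp [hb]) (by simp)] at this
  simpa [fullLen] using this

lemma IsBisymbol.scaled_le [NeZero n] {lam : ℝ → ℝ} (hlam : Admissible lam) {t : ℝ}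
    {a : Vec n → Vec n → Vec n → ℂ} (ha : IsBisymbol lam 0 0 t a) {h : ℝ} (hh : 0 < h)
    (hh1 : h ≤ 1) {r r' : ℤ} (j : Fin n) {i : ℕ} (hi : i ≤ 2 * n) {A₁ A₃ : Fin n → ℕ}
    (hA₁ : ∀ i, A₁ i ≤ 1) (hA₃ : ∀ i, A₃ i ≤ 1) {x y : Vec n} (ξ : Vec n)
    (hx : |x 0 - r| ≤ 1) (hy : |y 0 - r'| ≤ 1) :
    h ^ i * ‖d1B A₁ (d2B (Pi.single j i) (d3B A₃ a)) x ξ y‖ *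
      ((∏ i, scale h (lamT lam t r r') i ^ A₁ i) * ∏ i, scale h (lamT lam t r r') i ^ A₃ i) ≤
      (biSup a + √h * bisymSeminorm lam (4 * n) 0 0 t a) *
        scale h (lamT lam t r r') j ^ i := by
  have hμ := lamT_pos hlam t r r'
  set μ := lamT lam t r r' with hμd
  set B : Fin n → ℕ := Pi.single j i with hB
  have hB' : fullLen B = i := by simp [hB, fullLen]
  have hle : ∀ A : Fin n → ℕ, (∀ i, A i ≤ 1) → fullLen A ≤ n := fun A hA => by
    simpa [fullLen] using Finset.sum_le_card_nsmul Finset.univ A 1 fun i _ => hA i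
  have h1 := hle A₁ hA₁
  have h3 := hle A₃ hA₃
  set W := μ ^ ((angLen B : ℤ) - (angLen A₁ : ℤ) - (angLen A₃ : ℤ)) *
      ‖d1B A₁ (d2B B (d3B A₃ a)) x ξ y‖ with hW
  have hS := bisymSeminorm_nonneg hlam (4 * n) t a
  have hWS : W ≤ bisymSeminorm lam (4 * n) 0 0 t a :=
    ha.le_bisymSeminorm hlam (by lia) hx hy
  have hW0 : 0 ≤ W := by positivity
  have hs : 0 < √h := Real.sqrt_pos.2 hh
  have hs1 : √h ≤ 1 := Real.sqrt_le_one.2 hh1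
  have hb0 : 0 ≤ biSup a := (norm_nonneg _).trans (ha.norm_le_biSup x ξ y)
  have key : √h ^ (fullLen A₁ + i + fullLen A₃) * W ≤
      biSup a + √h * bisymSeminorm lam (4 * n) 0 0 t a := by
    rcases Nat.eq_zero_or_pos (fullLen A₁ + i + fullLen A₃) with h0 | h0
    · have hz : ∀ A : Fin n → ℕ, fullLen A = 0 → A = 0 := fun A hA =>
        funext fun i => by simpa using (le_fullLen A i).trans_eq hA
      have e1 : A₁ = 0 := hz _ (by lia)
      have e2 : B = 0 := hz _ (by lia)
      have e3 : A₃ = 0 := hz _ (by lia)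
      have : W = ‖a x ξ y‖ := by
        rw [hW, e1, e2, e3]
        simp [d1B, d2B, d3B, mpd_fun_zero, angLen]
      rw [h0, pow_zero, one_mul, this]
      have := ha.norm_le_biSup x ξ y
      have : 0 ≤ √h * bisymSeminorm lam (4 * n) 0 0 t a := by positivity
      linarith
    · have : √h ^ (fullLen A₁ + i + fullLen A₃) ≤ √h := pow_le_of_le_one hs.le hs1 (by lia)
      have := mul_le_mul this hWS hW0 hs.le
      linarith
  have hsq : h ^ i = √h ^ i * √h ^ i := by rw [← mul_pow, Real.mul_self_sqrt hh.le]
  have hWe : W = μ ^ angLen B * (μ ^ angLen A₁)⁻¹ * (μ ^ angLen A₃)⁻¹ *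
      ‖d1B A₁ (d2B B (d3B A₃ a)) x ξ y‖ := by
    rw [hW, zpow_sub₀ hμ.ne', zpow_sub₀ hμ.ne']
    simp only [zpow_natCast, div_eq_mul_inv]
  rw [prod_scale_pow, prod_scale_pow, scale_pow, ← hB]
  calc _ = √h ^ (fullLen A₁ + i + fullLen A₃) * W * (√h ^ i * (μ ^ angLen B)⁻¹) := by
        rw [hWe, hsq, pow_add, pow_add]
        field_simp
    _ ≤ _ := mul_le_mul_of_nonneg_right key (by positivity)

end SymbolBounds

section Cutoff

variable {n : ℕ}

lemma pdC_comp_smul (c : ℝ) (j : Fin n) (f : Vec n → ℂ) :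
    pdC j (fun ξ => f (c • ξ)) = fun ξ => (c : ℂ) * pdC j f (c • ξ) := by
  funext ξ
  rw [pdC, fderiv_comp_smul]
  simp [pdC]

lemma pdC_const_mul (c : ℂ) (j : Fin n) (f : Vec n → ℂ) :
    pdC j (fun ξ => c * f ξ) = fun ξ => c * pdC j f ξ := by
  funext ξ
  have h := congrFun (fderiv_const_smul_field (𝕜 := ℝ) (f := f) c) ξ
  rw [pdC, show (fun ξ => c * f ξ) = c • f from rfl, h]
  rfl

lemma pdC_iterate_comp_smul (c : ℝ) (j : Fin n) (i : ℕ) (f : Vec n → ℂ) :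
    (pdC j)^[i] (fun ξ => f (c • ξ)) = fun ξ => (c : ℂ) ^ i * (pdC j)^[i] f (c • ξ) := by
  induction i with
  | zero => simp
  | succ i ih =>
    rw [Function.iterate_succ_apply', ih, pdC_const_mul, pdC_comp_smul]
    simp only [Function.iterate_succ_apply']
    funext ξ; ring

lemma contDiff_pdC_iterate_const {χ : Vec n → ℂ} (hχ : ContDiff ℝ (⊤ : ℕ∞) χ) (j : Fin n) (i : ℕ) :
    ContDiff ℝ (⊤ : ℕ∞) ((pdC j)^[i] χ) := by
  induction i with
  | zero => exact hχ
  | succ i ih => rw [Function.iterate_succ_apply']; exact contDiff_pdC_const ih j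

lemma pdC_iterate_eq_zero_of_norm_lt {χ : Vec n → ℂ} {R : ℝ} (hχ0 : ∀ ξ, R < ‖ξ‖ → χ ξ = 0)
    (j : Fin n) (i : ℕ) : ∀ ξ, R < ‖ξ‖ → (pdC j)^[i] χ ξ = 0 := by
  induction i with
  | zero => exact hχ0
  | succ i ih => rw [Function.iterate_succ_apply']; exact pdC_eq_zero_of_norm_lt ih j

/-- A smooth cutoff function with control of finitely many pure derivatives. -/
lemma exists_cutoff (n N : ℕ) : ∃ A > 0, ∃ χ : Vec n → ℂ, ContDiff ℝ (⊤ : ℕ∞) χ ∧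
    (∀ ξ, ‖ξ‖ ≤ 1 → χ ξ = 1) ∧ (∀ ξ, 2 < ‖ξ‖ → χ ξ = 0) ∧ (∀ ξ, ‖χ ξ‖ ≤ 1) ∧
    ∀ i ≤ N, ∀ j ξ, ‖(pdC j)^[i] χ ξ‖ ≤ A := by
  let b : ContDiffBump (0 : Vec n) := ⟨1, 2, one_pos, one_lt_two⟩
  have hs : ContDiff ℝ (⊤ : ℕ∞) fun ξ => ((b ξ : ℝ) : ℂ) :=
    Complex.ofRealCLM.contDiff.comp b.contDiff
  have h0 : ∀ ξ : Vec n, 2 < ‖ξ‖ → ((b ξ : ℝ) : ℂ) = 0 := fun ξ hξ => by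
    rw [b.zero_of_le_dist (by simpa using hξ.le), Complex.ofReal_zero]
  have hb : ∀ (i : ℕ) (j : Fin n), ∃ C, ∀ ξ, ‖(pdC j)^[i] (fun ξ => ((b ξ : ℝ) : ℂ)) ξ‖ ≤ C := by
    intro i j
    refine (contDiff_pdC_iterate_const hs j i).continuous.bounded_above_of_compact_support
      (HasCompactSupport.intro (isCompact_closedBall (0 : Vec n) 2) fun ξ hξ => ?_)
    exact pdC_iterate_eq_zero_of_norm_lt h0 j i ξ (by simpa using hξ)
  choose C hC using hb
  have hC0 : ∀ i j, 0 ≤ C i j := fun i j => (norm_nonneg _).trans (hC i j 0)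
  refine ⟨1 + ∑ i ∈ Finset.range (N + 1), ∑ j, C i j,
    add_pos_of_pos_of_nonneg one_pos
      (Finset.sum_nonneg fun i _ => Finset.sum_nonneg fun j _ => hC0 i j),
    fun ξ => ((b ξ : ℝ) : ℂ), hs, fun ξ hξ => ?_, h0, fun ξ => ?_, fun i hi j ξ => ?_⟩
  · change ((b ξ : ℝ) : ℂ) = 1
    rw [b.one_of_mem_closedBall (by simpa using hξ), Complex.ofReal_one]
  · rw [Complex.norm_real, Real.norm_of_nonneg b.nonneg]
    exact b.le_one
  · have h1 := Finset.single_le_sum (f := fun j => C i j) (fun j _ => hC0 i j) (Finset.mem_univ j)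
    have h2 := Finset.single_le_sum (f := fun i => ∑ j, C i j)
      (fun i _ => Finset.sum_nonneg fun j _ => hC0 i j) (Finset.mem_range.2 (Nat.lt_succ_of_le hi))
    have h3 := hC i j ξ
    linarith

end Cutoff

section Limit

variable {n : ℕ}

/-- The oscillatory integral with frequency cutoff `χ`. -/
noncomputable def cutoffOp (h : ℝ) (χ : Vec n → ℂ) (F : Vec n → Vec n → Vec n → ℂ)
    (u : Vec n → ℂ) (x : Vec n) : ℂ :=
  ∫ ξ : Vec n, χ ξ * ∫ y : Vec n, F x (h • ξ) y * phase ξ x y * u y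

lemma measurable_cutoffOp {h : ℝ} {χ : Vec n → ℂ} (hχ : Continuous χ)
    {F : Vec n → Vec n → Vec n → ℂ}
    (hF : Continuous fun z : Vec n × Vec n × Vec n => F z.1 z.2.1 z.2.2)
    {u : Vec n → ℂ} (hu : Measurable u) : Measurable (cutoffOp h χ F u) := by
  have h1 : StronglyMeasurable fun z : (Vec n × Vec n) × Vec n =>
      F z.1.1 (h • z.1.2) z.2 * phase z.1.2 z.1.1 z.2 * u z.2 := by
    refine Measurable.stronglyMeasurable (Measurable.mul (Measurable.mul ?_ ?_)
      (hu.comp measurable_snd))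
    · exact (hF.comp (f := fun z : (Vec n × Vec n) × Vec n => (z.1.1, h • z.1.2, z.2))
        (by fun_prop)).measurable
    · exact (continuous_phase.comp (f := fun z : (Vec n × Vec n) × Vec n => (z.1.1, z.1.2, z.2))
        (by fun_prop)).measurable
  have h2 : StronglyMeasurable fun z : Vec n × Vec n =>
      χ z.2 * ∫ y : Vec n, F z.1 (h • z.2) y * phase z.2 z.1 y * u y :=
    (hχ.comp continuous_snd).stronglyMeasurable.mul h1.integral_prod_right'
  exact h2.integral_prod_right'.measurable

lemma norm_integral_phase_le {h B : ℝ} {F : Vec n → Vec n → Vec n → ℂ}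
    (hB : ∀ x ξ y, ‖F x ξ y‖ ≤ B) {u : Vec n → ℂ} (hu : BddSupp u) (x ξ : Vec n) :
    ‖∫ y : Vec n, F x (h • ξ) y * phase ξ x y * u y‖ ≤ B * ∫ y, ‖u y‖ := by
  rw [← integral_const_mul]
  refine norm_integral_le_of_norm_le (hu.integrable.norm.const_mul B)
    (Filter.Eventually.of_forall fun y => ?_)
  rw [norm_mul, norm_mul, norm_phase, mul_one]
  exact mul_le_mul_of_nonneg_right (hB _ _ _) (norm_nonneg _)

lemma norm_cutoffOp_le {h B R : ℝ} {χ : Vec n → ℂ} (hχ : Continuous χ)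
    (hχ0 : ∀ ξ, R < ‖ξ‖ → χ ξ = 0) {F : Vec n → Vec n → Vec n → ℂ}
    (hB : ∀ x ξ y, ‖F x ξ y‖ ≤ B) {u : Vec n → ℂ} (hu : BddSupp u) (x : Vec n) :
    ‖cutoffOp h χ F u x‖ ≤ (∫ ξ, ‖χ ξ‖) * (B * ∫ y, ‖u y‖) := by
  have hχi : Integrable χ := hχ.integrable_of_hasCompactSupport
    (HasCompactSupport.intro (isCompact_closedBall (0 : Vec n) R) fun ξ hξ =>
      hχ0 ξ (by simpa using hξ))
  rw [← integral_mul_const]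
  refine norm_integral_le_of_norm_le (hχi.norm.mul_const _)
    (Filter.Eventually.of_forall fun ξ => ?_)
  rw [norm_mul]
  exact mul_le_mul_of_nonneg_left (norm_integral_phase_le hB hu x ξ) (norm_nonneg _)

lemma biForm_eq_integral_cutoffOp {h R : ℝ} {χ : Vec n → ℂ} (hχ : Continuous χ)
    (hχ0 : ∀ ξ, R < ‖ξ‖ → χ ξ = 0) {F : Vec n → Vec n → Vec n → ℂ}
    (hF : Continuous fun z : Vec n × Vec n × Vec n => F z.1 z.2.1 z.2.2)
    {v u : Vec n → ℂ} (hv : BddSupp v) (hu : BddSupp u) :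
    biForm h χ F v u = ∫ x, v x * cutoffOp h χ F u x := by
  have hi := integrable_biForm (h := h) hχ hχ0 hF hv hu
  rw [Measure.volume_eq_prod] at hi
  rw [biForm, Measure.volume_eq_prod, integral_prod _ hi]
  refine integral_congr_ae (hi.prod_right_ae.mono fun x hx => ?_)
  simp only
  simp only at hx
  rw [Measure.volume_eq_prod] at hx ⊢
  rw [integral_prod _ hx, cutoffOp, ← integral_const_mul]
  refine integral_congr_ae (Filter.Eventually.of_forall fun ξ => ?_)
  simp only
  rw [← integral_const_mul, ← integral_const_mul]
  refine integral_congr_ae (Filter.Eventually.of_forall fun y => ?_)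
  simp only
  ring

lemma L2_indicator_cutoffOp_le {h B R : ℝ} {χ : Vec n → ℂ} (hχ : Continuous χ)
    (hχ0 : ∀ ξ, R < ‖ξ‖ → χ ξ = 0) {F : Vec n → Vec n → Vec n → ℂ}
    (hF : Continuous fun z : Vec n × Vec n × Vec n => F z.1 z.2.1 z.2.2)
    (hB : ∀ x ξ y, ‖F x ξ y‖ ≤ B) {u : Vec n → ℂ} (hu : BddSupp u)
    {S : Set (Vec n)} (hS : MeasurableSet S) {ρ : ℝ} (hSρ : ∀ x ∈ S, ‖x‖ ≤ ρ) {Q : ℝ}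
    (hQ0 : 0 ≤ Q)
    (hQ : ∀ v, BddSupp v → (∀ x, v x ≠ 0 → x ∈ S) → ‖biForm h χ F v u‖ ≤ Q * (L2 v * L2 u)) :
    BddSupp (S.indicator (cutoffOp h χ F u)) ∧
      L2 (S.indicator (cutoffOp h χ F u)) ≤ Q * L2 u := by
  have hT := measurable_cutoffOp (h := h) hχ hF hu.measurable
  have hw : BddSupp (S.indicator (cutoffOp h χ F u)) := by
    refine ⟨hT.indicator hS, (∫ ξ, ‖χ ξ‖) * (B * ∫ y, ‖u y‖), ρ, fun x => ⟨?_, fun hx => ?_⟩⟩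
    · exact (norm_indicator_le_norm_self _ _).trans (norm_cutoffOp_le hχ hχ0 hB hu x)
    · exact Set.indicator_of_notMem (fun hxS => (hSρ x hxS).not_gt hx) _
  refine ⟨hw, ?_⟩
  set w := S.indicator (cutoffOp h χ F u) with hwd
  have hv : BddSupp fun x => (starRingEnd ℂ) (w x) := hw.of_le (K := 1)
    (Complex.continuous_conj.measurable.comp hw.measurable) fun x => by simp
  have hvL : L2 (fun x => (starRingEnd ℂ) (w x)) = L2 w := by simp [L2]
  have h1 := hQ _ hv fun x hx => by
    by_contra hxS
    simp [hwd, hxS] at hx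
  have h2 : biForm h χ F (fun x => (starRingEnd ℂ) (w x)) u = ((L2 w ^ 2 : ℝ) : ℂ) := by
    rw [biForm_eq_integral_cutoffOp hχ hχ0 hF hv hu, L2_sq, ← integral_complex_ofReal]
    refine integral_congr_ae (Filter.Eventually.of_forall fun x => ?_)
    simp only [hwd]
    by_cases hx : x ∈ S
    · simp only [Set.indicator_of_mem hx, mul_comm ((starRingEnd ℂ) _)]
      rw [Complex.mul_conj, Complex.normSq_eq_norm_sq]
    · simp [hx]
  rw [h2, Complex.norm_real, Real.norm_of_nonneg (sq_nonneg _), hvL] at h1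
  rcases (L2_nonneg w).eq_or_lt with h0 | h0
  · rw [← h0]
    exact mul_nonneg hQ0 (L2_nonneg _)
  · nlinarith

lemma enorm_integral_le_liminf_cutoffOp {h : ℝ} {χ : ℕ → Vec n → ℂ}
    (hχ : ∀ m, Continuous (χ m)) (hχ1 : ∀ ξ, ∀ᶠ m in Filter.atTop, χ m ξ = 1)
    (hχb : ∀ m ξ, ‖χ m ξ‖ ≤ 1) (F : Vec n → Vec n → Vec n → ℂ) (u : Vec n → ℂ) (x : Vec n) :
    ‖∫ ξ : Vec n, ∫ y : Vec n, F x (h • ξ) y * phase ξ x y * u y‖ₑ ≤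
      Filter.liminf (fun m => ‖cutoffOp h (χ m) F u x‖ₑ) Filter.atTop := by
  by_cases hi : Integrable fun ξ : Vec n => ∫ y : Vec n, F x (h • ξ) y * phase ξ x y * u y
  · refine (Filter.Tendsto.liminf_eq ?_).ge
    refine (continuous_enorm.tendsto _).comp ?_
    refine tendsto_integral_of_dominated_convergence _
      (fun m => (hχ m).aestronglyMeasurable.mul hi.aestronglyMeasurable) hi.norm
      (fun m => Filter.Eventually.of_forall fun ξ => ?_)
      (Filter.Eventually.of_forall fun ξ => ?_)
    · rw [norm_mul]
      exact mul_le_of_le_one_left (norm_nonneg _) (hχb m ξ)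
    · refine tendsto_const_nhds.congr' ((hχ1 ξ).mono fun m hm => ?_)
      simp only [hm, one_mul]
  · rw [integral_undef hi]
    simp

lemma L2_le_of_lintegral_le {w : Vec n → ℂ} {K : ℝ} (hK : 0 ≤ K)
    (h : ∫⁻ x, ‖w x‖ₑ ^ 2 ≤ ENNReal.ofReal (K ^ 2)) : L2 w ≤ K := by
  refine Real.sqrt_le_iff.2 ⟨hK, ?_⟩
  refine (le_abs_self _).trans ((norm_integral_le_lintegral_norm (fun x => ‖w x‖ ^ 2)).trans ?_)
  refine ENNReal.toReal_le_of_le_ofReal (sq_nonneg K) (le_trans (le_of_eq ?_) h)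
  refine lintegral_congr fun x => ?_
  rw [norm_pow, norm_norm, ENNReal.ofReal_pow (norm_nonneg _), ofReal_norm]

lemma BddSupp.lintegral_enorm_sq {w : Vec n → ℂ} (hw : BddSupp w) :
    ∫⁻ x, ‖w x‖ₑ ^ 2 = ENNReal.ofReal (L2 w ^ 2) := by
  rw [L2_sq, ofReal_integral_eq_lintegral_ofReal hw.integrable_sq
    (Filter.Eventually.of_forall fun x => sq_nonneg _)]
  refine lintegral_congr fun x => ?_
  rw [ENNReal.ofReal_pow (norm_nonneg _), ofReal_norm]

/-- Uniform form bounds for the frequency cutoffs imply an `L²` bound for the iterated integral. -/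
lemma L2_le_of_norm_biForm_le {h B c Q : ℝ} {χ : ℕ → Vec n → ℂ} {R : ℕ → ℝ}
    (hχ : ∀ m, Continuous (χ m)) (hχ0 : ∀ m ξ, R m < ‖ξ‖ → χ m ξ = 0)
    (hχ1 : ∀ ξ, ∀ᶠ m in Filter.atTop, χ m ξ = 1) (hχb : ∀ m ξ, ‖χ m ξ‖ ≤ 1)
    {F : Vec n → Vec n → Vec n → ℂ}
    (hF : Continuous fun z : Vec n × Vec n × Vec n => F z.1 z.2.1 z.2.2)
    (hB : ∀ x ξ y, ‖F x ξ y‖ ≤ B) {u : Vec n → ℂ} (hu : BddSupp u)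
    {S : Set (Vec n)} (hS : MeasurableSet S) (hQ0 : 0 ≤ Q)
    (hQ : ∀ᶠ m in Filter.atTop, ∀ v, BddSupp v → (∀ x, v x ≠ 0 → x ∈ S) →
      ‖biForm h (χ m) F v u‖ ≤ Q * (L2 v * L2 u)) (hc : 0 ≤ c) {w : Vec n → ℂ}
    (hw : ∀ x ∈ S, ‖w x‖ ≤ c * ‖∫ ξ : Vec n, ∫ y : Vec n, F x (h • ξ) y * phase ξ x y * u y‖)
    (hw0 : ∀ x ∉ S, w x = 0) : L2 w ≤ c * (Q * L2 u) := by
  have hK : 0 ≤ Q * L2 u := mul_nonneg hQ0 (L2_nonneg _)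
  set T : ℕ → Set (Vec n) := fun m => S ∩ Metric.closedBall 0 m
  have hT : ∀ m, MeasurableSet (T m) := fun m => hS.inter Metric.isClosed_closedBall.measurableSet
  set W : ℕ → Vec n → ℂ := fun m => (T m).indicator (cutoffOp h (χ m) F u)
  have hWm : ∀ m, Measurable (W m) := fun m =>
    (measurable_cutoffOp (hχ m) hF hu.measurable).indicator (hT m)
  have hW : ∀ᶠ m in Filter.atTop, ∫⁻ x, ‖W m x‖ₑ ^ 2 ≤ ENNReal.ofReal ((Q * L2 u) ^ 2) := by
    filter_upwards [hQ] with m hm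
    obtain ⟨h1, h2⟩ := L2_indicator_cutoffOp_le (hχ m) (hχ0 m) hF hB hu (hT m)
      (ρ := m) (fun x hx => by simpa using hx.2) hQ0
      fun v hv hvT => hm v hv fun x hx => (hvT x hx).1
    rw [h1.lintegral_enorm_sq]
    exact ENNReal.ofReal_le_ofReal (pow_le_pow_left₀ (L2_nonneg _) h2 2)
  have hpt : ∀ x, ‖w x‖ₑ ^ 2 ≤
      ENNReal.ofReal (c ^ 2) * Filter.liminf (fun m => ‖W m x‖ₑ ^ 2) Filter.atTop := by
    intro x
    by_cases hx : x ∈ S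
    · have h1 : ‖w x‖ₑ ≤ ENNReal.ofReal c *
          ‖∫ ξ : Vec n, ∫ y : Vec n, F x (h • ξ) y * phase ξ x y * u y‖ₑ := by
        rw [← ofReal_norm, ← ofReal_norm, ← ENNReal.ofReal_mul hc]
        exact ENNReal.ofReal_le_ofReal (hw x hx)
      have h2 : ∀ᶠ m in Filter.atTop, cutoffOp h (χ m) F u x = W m x := by
        filter_upwards [Filter.eventually_ge_atTop ⌈‖x‖⌉₊] with m hm
        have : x ∈ T m := ⟨hx, by simpa using Nat.ceil_le.1 hm⟩
        simp only [W, Set.indicator_of_mem this]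
      have h3 : Filter.liminf (fun m => ‖cutoffOp h (χ m) F u x‖ₑ) Filter.atTop ^ 2 =
          Filter.liminf (fun m => ‖W m x‖ₑ ^ 2) Filter.atTop := by
        have hmono : Monotone fun t : ENNReal => t ^ 2 := fun a b hab => by
          dsimp only; gcongr
        refine (hmono.map_liminf_of_continuousAt (F := Filter.atTop)
          (fun m => ‖cutoffOp h (χ m) F u x‖ₑ)
          (ENNReal.continuous_pow 2).continuousAt).trans ?_
        exact Filter.liminf_congr (h2.mono fun m hm => by simp [hm])
      calc ‖w x‖ₑ ^ 2 ≤ (ENNReal.ofReal c *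
            Filter.liminf (fun m => ‖cutoffOp h (χ m) F u x‖ₑ) Filter.atTop) ^ 2 := by
            refine pow_le_pow_left' (h1.trans ?_) 2
            gcongr
            exact enorm_integral_le_liminf_cutoffOp hχ hχ1 hχb F u x
        _ = _ := by rw [mul_pow, h3, ENNReal.ofReal_pow hc]
    · rw [hw0 x hx]; simp
  refine L2_le_of_lintegral_le (mul_nonneg hc hK) ?_
  calc ∫⁻ x, ‖w x‖ₑ ^ 2 ≤ ∫⁻ x, ENNReal.ofReal (c ^ 2) *
        Filter.liminf (fun m => ‖W m x‖ₑ ^ 2) Filter.atTop := lintegral_mono hpt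
    _ = ENNReal.ofReal (c ^ 2) * ∫⁻ x, Filter.liminf (fun m => ‖W m x‖ₑ ^ 2) Filter.atTop :=
        lintegral_const_mul' _ _ ENNReal.ofReal_ne_top
    _ ≤ ENNReal.ofReal (c ^ 2) * ENNReal.ofReal ((Q * L2 u) ^ 2) := by
        gcongr
        refine (lintegral_liminf_le fun m => (hWm m).enorm.pow_const 2).trans ?_
        refine (Filter.liminf_le_liminf hW).trans ?_
        simp
    _ = _ := by rw [← ENNReal.ofReal_mul (sq_nonneg c), ← mul_pow]

end Limit

section Main

variable {n : ℕ}

lemma le_one_of_tsum_eq_one {ψ : ℝ → ℝ} (hψpos : ∀ r, 0 ≤ ψ r)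
    (hψsum : ∀ r : ℝ, ∑' j : ℤ, ψ (r - j) = 1) (r : ℝ) : ψ r ≤ 1 := by
  have hs : Summable fun j : ℤ => ψ (r - j) := by
    by_contra hs
    have := hψsum r
    rw [tsum_eq_zero_of_not_summable hs] at this
    exact zero_ne_one this
  have := hs.le_tsum 0 fun j _ => hψpos _
  rw [hψsum] at this
  simpa using this

lemma abs_le_one_of_apply_ne_zero {ψ : ℝ → ℝ} (hψsupp : tsupport ψ ⊆ Set.Ioo (-1 : ℝ) 1) {r : ℝ}
    (hr : ψ r ≠ 0) : |r| ≤ 1 := by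
  have := hψsupp (subset_tsupport ψ hr)
  exact abs_le.2 ⟨this.1.le, this.2.le⟩

lemma BddSupp.of_continuous {u : Vec n → ℂ} (hu : Continuous u) (hc : HasCompactSupport u) :
    BddSupp u := by
  obtain ⟨C, hC⟩ := hu.bounded_above_of_compact_support hc
  obtain ⟨R, hR⟩ := hc.isCompact.isBounded.subset_closedBall 0
  refine ⟨hu.measurable, C, R, fun x => ⟨hC x, fun hx => ?_⟩⟩
  refine image_eq_zero_of_notMem_tsupport fun h => ?_
  have := hR h
  rw [mem_closedBall_zero_iff] at this
  exact this.not_gt hx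

lemma eventually_inv_le_scale [NeZero n] {h μ : ℝ} (hh : 0 < h) (hμ : 0 < μ) :
    ∀ᶠ m : ℕ in Filter.atTop, ∀ i : Fin n, ((m : ℝ) + 1)⁻¹ ≤ scale h μ i := by
  refine Filter.eventually_all.2 fun i => ?_
  have := tendsto_one_div_add_atTop_nhds_zero_nat (𝕜 := ℝ)
  filter_upwards [this.eventually (eventually_le_nhds (scale_pos hh hμ i))] with m hm
  simpa using hm

end Main

/-- **Proposition 3.8.**  Let `λ` satisfy the admissibility condition and `ψ` be the
partition-of-unity function.  There are `C > 0` and `M ≥ 0` such that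
`‖ψ_j Op_ħ(a) ψ_k u‖_{L²} ≤ C (‖a‖_{L^∞} + ħ^{1/2} |a|_{λ:M,0,0,t}) ‖u‖_{L²}`
for all `t ∈ [0,1]`, all `a ∈ BS⁰₀(λ;t)`, all `j, k ∈ ℤ`, all `ħ ∈ (0,1]` and all
`u ∈ C_c^∞(ℝⁿ)`. -/
theorem psi_Oph_psi_semiclassical
    (n : ℕ) [NeZero n] (lam : ℝ → ℝ) (hlam : Admissible lam)
    (ψ : ℝ → ℝ) (hψ : ContDiff ℝ (⊤ : ℕ∞) ψ) (hψsupp : tsupport ψ ⊆ Set.Ioo (-1 : ℝ) 1)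
    (hψpos : ∀ r, 0 ≤ ψ r) (hψsum : ∀ r : ℝ, ∑' j : ℤ, ψ (r - j) = 1) :
    ∃ C > 0, ∃ M : ℕ, ∀ t ∈ Set.Icc (0 : ℝ) 1,
      ∀ a : Vec n → Vec n → Vec n → ℂ, IsBisymbol lam 0 0 t a →
        ∀ j k : ℤ, ∀ h ∈ Set.Ioc (0 : ℝ) 1,
          ∀ u : Vec n → ℂ, ContDiff ℝ (⊤ : ℕ∞) u → HasCompactSupport u →
            L2 (fun q => (ψ (q 0 - j) : ℂ) *
                  Oph h a (fun q' => (ψ (q' 0 - k) : ℂ) * u q') q)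
              ≤ C * (biSup a + Real.sqrt h * bisymSeminorm lam M 0 0 t a) * L2 u := by
  obtain ⟨A, hA, χ, hχ, hχ1, hχ0, hχb, hχA⟩ := exists_cutoff n (2 * n)
  set c : ℝ := (2 * π) ^ (-(n : ℤ)) with hc
  have hc0 : 0 < c := by positivity
  have hcv := cvConst_pos n
  refine ⟨c * (cvConst n * A), by positivity, 4 * n, ?_⟩
  intro t _ a ha j k h hh u hu huc
  have hμ := lamT_pos hlam t j k
  have hψb := le_one_of_tsum_eq_one hψpos hψsum
  have hψn : ∀ r, ‖(ψ r : ℂ)‖ ≤ 1 := fun r => by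
    rw [Complex.norm_real, Real.norm_of_nonneg (hψpos r)]
    exact hψb r
  have hψm : Measurable fun q : Vec n => (ψ (q 0 - k) : ℂ) :=
    (Complex.continuous_ofReal.comp (hψ.continuous.comp (by fun_prop))).measurable
  have huB := BddSupp.of_continuous hu.continuous huc
  set u' : Vec n → ℂ := fun q => (ψ (q 0 - k) : ℂ) * u q with hu'
  have hu'le : ∀ q, ‖u' q‖ ≤ 1 * ‖u q‖ := fun q => by
    rw [hu', norm_mul]
    exact mul_le_mul_of_nonneg_right (hψn _) (norm_nonneg _)
  have hu'B : BddSupp u' := huB.of_le (hψm.mul huB.measurable) hu'le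
  have hu'L : L2 u' ≤ L2 u := by simpa using huB.L2_le zero_le_one hu'le
  set K := biSup a + √h * bisymSeminorm lam (4 * n) 0 0 t a with hK
  have hK0 : 0 ≤ K := by
    have := bisymSeminorm_nonneg hlam (4 * n) t a
    have := (norm_nonneg _).trans (ha.norm_le_biSup 0 0 0)
    positivity
  set X : ℕ → Vec n → ℂ := fun m ξ => χ (((m : ℝ) + 1)⁻¹ • ξ) with hX
  have hXs : ∀ m, ContDiff ℝ (⊤ : ℕ∞) (X m) := fun m => hχ.comp (contDiff_const_smul _)
  have hXn : ∀ (m : ℕ) (ξ : Vec n), ‖((m : ℝ) + 1)⁻¹ • ξ‖ = ((m : ℝ) + 1)⁻¹ * ‖ξ‖ := fun m ξ => by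
    rw [norm_smul, Real.norm_of_nonneg (by positivity)]
  have hX0 : ∀ (m : ℕ) ξ, 2 * ((m : ℝ) + 1) < ‖ξ‖ → X m ξ = 0 := fun m ξ hξ => by
    refine hχ0 _ ?_
    rw [hXn, inv_mul_eq_div, lt_div_iff₀ (by positivity)]
    exact hξ
  have hX1 : ∀ ξ, ∀ᶠ m in Filter.atTop, X m ξ = 1 := fun ξ => by
    filter_upwards [Filter.eventually_ge_atTop ⌈‖ξ‖⌉₊] with m hm
    refine hχ1 _ ?_
    rw [hXn, inv_mul_le_iff₀ (by positivity), mul_one]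
    linarith [Nat.ceil_le.1 hm]
  set S : Set (Vec n) := {x | |x 0 - j| ≤ 1} with hS
  have hSm : MeasurableSet S :=
    (isClosed_le (f := fun x : Vec n => |x 0 - j|) (by fun_prop) continuous_const).measurableSet
  have hforms : ∀ᶠ m in Filter.atTop, ∀ v, BddSupp v → (∀ x, v x ≠ 0 → x ∈ S) →
      ‖biForm h (X m) a v u'‖ ≤ cvConst n * (A * K) * (L2 v * L2 u') := by
    filter_upwards [eventually_inv_le_scale (n := n) hh.1 hμ] with m hm v hv hvS
    refine norm_biForm_le hh.1 (scale_pos hh.1 hμ) (r := j) (r' := k) (hXs m) (hX0 m)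
      (fun i hi l ξ => ?_) ha.1 (fun l i hi A₁ h1 A₃ h3 x y ξ hx hy =>
        ha.scaled_le hlam hh.1 hh.2 l hi h1 h3 ξ hx hy) hv hvS hu'B fun x hx =>
        abs_le_one_of_apply_ne_zero hψsupp fun h0 => hx ?_
    · rw [pdC_iterate_comp_smul, norm_mul, norm_pow, Complex.norm_real,
        Real.norm_of_nonneg (by positivity), mul_comm]
      exact mul_le_mul (hχA i hi l _) (pow_le_pow_left₀ (by positivity) (hm l) i)
        (by positivity) hA.le
    · simp [hu', h0]
  have main := L2_le_of_norm_biForm_le (w := fun q => (ψ (q 0 - j) : ℂ) * Oph h a u' q)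
    (fun m => (hXs m).continuous) hX0 hX1
    (fun m ξ => hχb _) ha.1.continuous ha.norm_le_biSup hu'B hSm (by positivity) hforms hc0.le
    (fun x _ => ?_) (fun x hx => ?_)
  · calc _ ≤ c * (cvConst n * (A * K) * L2 u') := main
      _ ≤ c * (cvConst n * (A * K) * L2 u) := by gcongr
      _ = _ := by ring
  · rw [norm_mul, Oph, Op, norm_mul, Complex.norm_real, Complex.norm_real, ← hc,
      Real.norm_of_nonneg hc0.le, ← Complex.norm_real (ψ _)]
    exact mul_le_of_le_one_left (by positivity) (hψn _)
  · have : ψ (x 0 - j) = 0 := by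
      by_contra h0
      exact hx (abs_le_one_of_apply_ne_zero hψsupp h0)
    simp [this]
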